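/- arXiv:0903.3978 — 2 statements merged into one kernel-verified Lean document; each statement's English description precedes it below -/
import Mathlib

section
/- For every odd prime p, the universal theory of the class of p-groups is undecidable: there is no computable function deciding, for a given universal sentence in the language of groups, whether it holds in every group in which each element has order a power of p. -/
open FirstOrder

/-- The first-order language of groups: one binary function symbol (multiplication),
one unary function symbol (inversion), and one constant symbol (identity). -/
def grpLang : FirstOrder.Language where
  Functions := fun n =>
    match n with
    | 0 => Unit
    | 1 => Unit
    | 2 => Unit
    | _ + 3 => Empty
  Relations := fun _ => Empty

/-- Every group is naturally a structure for the language of groups. -/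
instance grpStructure (G : Type*) [Group G] : grpLang.Structure G where
  funMap := fun {n} f x =>
    match n, f, x with
    | 0, _, _ => (1 : G)
    | 1, _, x => (x 0)⁻¹
    | 2, _, x => x 0 * x 1
    | _ + 3, f, _ => f.elim
  RelMap := fun {_} r _ => r.elim

/-- A universal sentence is one of the form `∀ x₁ … ∀ xₖ, Φ` with `Φ` quantifier-free. -/
def IsUniversalSentence (φ : grpLang.Sentence) : Prop :=
  ∃ (k : ℕ) (ψ : grpLang.BoundedFormula Empty k), ψ.IsQF ∧ φ = ψ.alls

/-- A fixed effective encoding of the symbols of `grpLang`. -/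
instance grpFunEncodable (n : ℕ) : Encodable (grpLang.Functions n) :=
  match n with
  | 0 => inferInstanceAs (Encodable Unit)
  | 1 => inferInstanceAs (Encodable Unit)
  | 2 => inferInstanceAs (Encodable Unit)
  | _ + 3 => inferInstanceAs (Encodable Empty)

instance grpRelEncodable (n : ℕ) : Encodable (grpLang.Relations n) :=
  inferInstanceAs (Encodable Empty)

/-- The fixed effective encoding of first-order formulas of `grpLang` (via Mathlib's
list encoding of bounded formulas). -/
instance grpSigmaBFEncodable : Encodable (Σ n, grpLang.BoundedFormula Empty n) :=
  Encodable.ofLeftInjection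
    (fun φ => φ.2.listEncode)
    (fun l => (FirstOrder.Language.BoundedFormula.listDecode l)[0]?)
    (fun φ => FirstOrder.Language.BoundedFormula.encoding.decode_encode φ)

/-- The fixed effective encoding of `grpLang`-sentences as natural numbers. -/
instance grpSentenceEncodable : Encodable grpLang.Sentence :=
  Encodable.ofLeftInjection
    (fun φ => (⟨0, φ⟩ : Σ n, grpLang.BoundedFormula Empty n))
    (fun ψ => match ψ with | ⟨0, φ⟩ => some φ | _ => none)
    (fun _ => rfl)


namespace Stein

section words
open scoped commutatorElement
variable {G : Type*} [Group G] {A : Type*}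

/-- Steinberg-type relations between root elements indexed by letters. -/
structure St (X : Fin 5 → Fin 5 → A → G) : Prop where
  comm : ∀ i j k l s t, i ≠ j → k ≠ l → i ≠ l → j ≠ k → Commute (X i j s) (X k l t)
  mid : ∀ i j l k s t, i ≠ k → j ≠ i → j ≠ k → l ≠ i → l ≠ k →
    ⁅X i j s, X j k t⁆ = ⁅X i l s, X l k t⁆

/-- An index different from the two given ones. -/
def third (i j : Fin 5) : Fin 5 :=
  if 0 ≠ i ∧ 0 ≠ j then 0 else if 1 ≠ i ∧ 1 ≠ j then 1 else 2

theorem third_ne : ∀ i j : Fin 5, third i j ≠ i ∧ third i j ≠ j := by decide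

theorem fresh4 : ∀ i j k l : Fin 5, ∃ m, m ≠ i ∧ m ≠ j ∧ m ≠ k ∧ m ≠ l := by decide

/-- The group element attached to a word of letters. -/
def XW (X : Fin 5 → Fin 5 → A → G) : Fin 5 → Fin 5 → List A → G
  | _, _, [] => 1
  | i, j, [s] => X i j s
  | i, j, s :: t :: w => ⁅X i (third i j) s, XW X (third i j) j (t :: w)⁆

theorem commute_commutator {a b c : G} (h1 : Commute a c) (h2 : Commute b c) :
    Commute ⁅a, b⁆ c := by
  rw [commutatorElement_def]
  exact ((h1.mul_left h2).mul_left h1.inv_left).mul_left h2.inv_left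

theorem assoc_comm {a b c : G} (hac : Commute a c) (h1 : Commute ⁅b, c⁆ ⁅a, b⁆)
    (h2 : Commute ⁅b, c⁆ c) : ⁅⁅a, b⁆, c⁆ = ⁅a, ⁅b, c⁆⁆ := by
  have key : ⁅⁅a, b⁆, c⁆ = ⁅b, c⁆⁻¹ * a * ⁅b, c⁆ * a⁻¹ := by
    have e1 : c * ⁅a, b⁆ * c⁻¹ = ⁅a, ⁅b, c⁆⁻¹ * b⁆ := by
      have hb : ⁅b, c⁆⁻¹ * b = c * b * c⁻¹ := by
        rw [commutatorElement_def]; group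
      have ha : a = c * a * c⁻¹ := by rw [← hac.eq]; group
      rw [hb]
      conv_rhs => rw [ha]
      simp only [commutatorElement_def]; group
    have e2 : ⁅a, ⁅b, c⁆⁻¹ * b⁆ = a * ⁅b, c⁆⁻¹ * a⁻¹ * (⁅a, b⁆ * ⁅b, c⁆) := by
      generalize ⁅b, c⁆ = d
      simp only [commutatorElement_def]; group
    rw [← h1.eq] at e2
    have e3 : ⁅⁅a, b⁆, c⁆ = ⁅a, b⁆ * (c * ⁅a, b⁆ * c⁻¹)⁻¹ := by
      generalize ⁅a, b⁆ = d
      simp only [commutatorElement_def]; group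
    rw [e3, e1, e2]
    generalize ⁅b, c⁆ = d
    generalize ⁅a, b⁆ = e
    group
  have hc : Commute ⁅b, c⁆ ⁅⁅a, b⁆, c⁆ := (commute_commutator h1.symm h2.symm).symm
  rw [key] at hc ⊢
  have := hc.eq
  generalize ⁅b, c⁆ = d at *
  have h3 : d⁻¹ * a * d * a⁻¹ = d * (d⁻¹ * a * d * a⁻¹) * d⁻¹ := by rw [this]; group
  rw [h3, commutatorElement_def]; group

variable {X : Fin 5 → Fin 5 → A → G}

/-- Left multiplication by a letter, for words of length at most `n`. -/
def LB (X : Fin 5 → Fin 5 → A → G) (n : ℕ) : Prop :=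
  ∀ (s : A) (v : List A), v ≠ [] → v.length + 1 ≤ n → ∀ i j k, i ≠ j → i ≠ k → j ≠ k →
    ⁅X i j s, XW X j k v⁆ = XW X i k (s :: v)

theorem comm_letter (h : St X) {n : ℕ} (hB : LB X n) (v : List A) (hv : v ≠ [])
    (hn : v.length ≤ n) (s : A) (i j k l : Fin 5)
    (hij : i ≠ j) (hkl : k ≠ l) (hil : i ≠ l) (hjk : j ≠ k) :
    Commute (X i j s) (XW X k l v) := by
  induction v generalizing k l with
  | nil => exact absurd rfl hv
  | cons t w ih =>
    rcases w with _ | ⟨t', w⟩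
    · exact h.comm _ _ _ _ _ _ hij hkl hil hjk
    · obtain ⟨m, m1, m2, m3, m4⟩ := fresh4 i j k l
      rw [← hB t (t' :: w) (by simp) (by simpa using hn) k m l m3.symm hkl m4]
      refine (commute_commutator ?_ ?_).symm
      · exact (h.comm _ _ _ _ _ _ hij m3.symm m1.symm hjk).symm
      · exact (ih (by simp) (by simp at hn ⊢; omega) m l m4 hil m2.symm).symm

theorem comm_words (h : St X) {n : ℕ} (hB : LB X n) (u v : List A) (hu : u ≠ []) (hv : v ≠ [])
    (hun : u.length ≤ n) (hn : v.length ≤ n) (i j k l : Fin 5)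
    (hij : i ≠ j) (hkl : k ≠ l) (hil : i ≠ l) (hjk : j ≠ k) :
    Commute (XW X i j u) (XW X k l v) := by
  induction u generalizing i j with
  | nil => exact absurd rfl hu
  | cons t w ih =>
    rcases w with _ | ⟨t', w⟩
    · exact comm_letter h hB v hv hn _ _ _ _ _ hij hkl hil hjk
    · obtain ⟨m, m1, m2, m3, m4⟩ := fresh4 i j k l
      rw [← hB t (t' :: w) (by simp) (by simpa using hun) i m j m1.symm hij m2]
      refine (commute_commutator ?_ ?_)
      · exact comm_letter h hB v hv hn _ _ _ _ _ m1.symm hkl hil m3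
      · exact ih (by simp) (by simp at hun ⊢; omega) m j m2 m4 hjk

theorem LB_all (h : St X) (n : ℕ) : LB X n := by
  induction n with
  | zero => intro s v hv hn; omega
  | succ n hB =>
    intro s v hv hn
    rcases v with _ | ⟨t, v⟩
    · exact absurd rfl hv
    rcases v with _ | ⟨t', v⟩
    · intro i j k hij hik hjk
      simp only [XW]
      exact h.mid _ _ _ _ _ _ hik hij.symm hjk (third_ne i k).1 (third_ne i k).2
    · set v' := t' :: v with hv'
      have hv'0 : v' ≠ [] := by simp [hv']
      have hn' : v'.length + 1 ≤ n := by simpa using hn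
      have key : ∀ i j k r, i ≠ j → i ≠ k → j ≠ k → r ≠ i → r ≠ j → r ≠ k →
          ⁅X i j s, XW X j k (t :: v')⁆ = ⁅⁅X i j s, X j r t⁆, XW X r k v'⁆ := by
        intro i j k r hij hik hjk hri hrj hrk
        have e := hB t v' hv'0 hn' j r k hrj.symm hjk hrk
        rw [← e]
        obtain ⟨m, m1, m2, m3, m4⟩ := fresh4 i j k r
        refine (assoc_comm ?_ ?_ ?_).symm
        · exact comm_letter h hB v' hv'0 (by omega) _ _ _ _ _ hij hrk hik hrj.symm
        · rw [e, h.mid i j m r s t hri.symm hij.symm hrj.symm m1 m4]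
          refine (commute_commutator ?_ ?_).symm
          · exact comm_letter h hB _ (by simp) (by simpa using hn') _ _ _ _ _ m1.symm hjk hik m2
          · exact comm_letter h hB _ (by simp) (by simpa using hn') _ _ _ _ _ m4 hjk m3 hrj
        · rw [e]
          exact comm_words h hB _ _ (by simp) hv'0 (by simpa using hn') (by omega)
            _ _ _ _ hjk hrk hjk hrk.symm
      intro i j k hij hik hjk
      obtain ⟨h1, h2⟩ := third_ne i k
      obtain ⟨r, r1, r2, r3, r4⟩ := fresh4 i j k (third i k)
      change _ = ⁅X i (third i k) s, XW X (third i k) k (t :: v')⁆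
      rw [key i j k r hij hik hjk r1 r2 r3, key i _ k r h1.symm hik h2 r1 r4 r3,
        h.mid i j _ r s t r1.symm hij.symm r2.symm h1 r4.symm]

theorem XW_cons (h : St X) (s : A) (v : List A) (hv : v ≠ []) (i j k : Fin 5)
    (hij : i ≠ j) (hik : i ≠ k) (hjk : j ≠ k) :
    ⁅X i j s, XW X j k v⁆ = XW X i k (s :: v) :=
  LB_all h _ s v hv le_rfl i j k hij hik hjk

theorem XW_append (h : St X) (u v : List A) (hu : u ≠ []) (hv : v ≠ []) (i j k : Fin 5)
    (hij : i ≠ j) (hik : i ≠ k) (hjk : j ≠ k) :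
    ⁅XW X i j u, XW X j k v⁆ = XW X i k (u ++ v) := by
  induction u generalizing i j with
  | nil => exact absurd rfl hu
  | cons s u ih =>
    rcases u with _ | ⟨t, u⟩
    · exact XW_cons h s v hv i j k hij hik hjk
    · obtain ⟨m, m1, m2, m3, -⟩ := fresh4 i j k k
      have e := XW_cons h s (t :: u) (by simp) i m j m1.symm hij m2
      have e2 := ih (by simp) m j m2 m3 hjk
      have hB := LB_all h ((s :: t :: u).length + v.length)
      rw [← e, assoc_comm]
      · rw [e2, XW_cons h _ _ (by simp) _ _ _ m1.symm hik m3]; rfl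
      · exact comm_letter h hB v hv (by omega) _ _ _ _ _ m1.symm hjk hik m2
      · rw [e, e2]
        exact comm_words h hB _ _ (by simp) (by simp) (by simp) (by simp) _ _ _ _ m3 hij m2 hik.symm
      · rw [e2]
        exact comm_words h hB _ _ (by simp) hv (by simp) (by omega) _ _ _ _ m3 hjk m3 hjk.symm

theorem XW_context (h : St X) (u v : List A) (hu : u ≠ []) (hv : v ≠ [])
    (huv : ∀ i j, i ≠ j → XW X i j u = XW X i j v) (a b : List A) (i j : Fin 5) (hij : i ≠ j) :
    XW X i j (a ++ (u ++ b)) = XW X i j (a ++ (v ++ b)) := by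
  have h1 : ∀ i j, i ≠ j → XW X i j (u ++ b) = XW X i j (v ++ b) := by
    intro i j hij
    rcases b with _ | ⟨t, b⟩
    · simpa using huv i j hij
    · obtain ⟨m, m1, m2, -, -⟩ := fresh4 i j i j
      rw [← XW_append h u _ hu (by simp) i m j m1.symm hij m2,
        ← XW_append h v _ hv (by simp) i m j m1.symm hij m2, huv i m m1.symm]
  rcases a with _ | ⟨t, a⟩
  · exact h1 i j hij
  · obtain ⟨m, m1, m2, -, -⟩ := fresh4 i j i j
    rw [← XW_append h _ (u ++ b) (by simp) (by simp [hu]) i m j m1.symm hij m2,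
      ← XW_append h _ (v ++ b) (by simp) (by simp [hv]) i m j m1.symm hij m2, h1 m j m2]

theorem XW_zero (h : St X) (u : List A) (hu : u ≠ [])
    (hz : ∀ i j, i ≠ j → XW X i j u = 1) (b : List A) (i j : Fin 5) (hij : i ≠ j) :
    XW X i j (u ++ b) = 1 := by
  rcases b with _ | ⟨t, b⟩
  · simpa using hz i j hij
  · obtain ⟨m, m1, m2, -, -⟩ := fresh4 i j i j
    rw [← XW_append h u _ hu (by simp) i m j m1.symm hij m2, hz i m m1.symm]
    simp

end words

end Stein

namespace Stein

/-- A deterministic multi-stack machine. -/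
structure SM (Q K Γ : Type) where
  /-- the stack read in a given state -/
  rd : Q → K
  /-- replacement of the top letter and the new state -/
  δ : Q → Γ → Option (List (K × Γ) × Q)
  ne : ∀ q x u q', δ q x = some (u, q') → u ≠ []

section machine
variable {Q K Γ : Type} [DecidableEq K]

/-- The contents of stack `k` given by a list of stack letters. -/
def stkOf (u : List (K × Γ)) (k : K) : List Γ :=
  u.filterMap fun y => if y.1 = k then some y.2 else none

theorem stkOf_nil (k : K) : stkOf ([] : List (K × Γ)) k = [] := rfl

theorem stkOf_cons (y : K × Γ) (u : List (K × Γ)) (k : K) :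
    stkOf (y :: u) k = if y.1 = k then y.2 :: stkOf u k else stkOf u k := by
  unfold stkOf
  by_cases h : y.1 = k <;> simp [h]

/-- One step of the machine. -/
def SM.step (M : SM Q K Γ) (c : Q × (K → List Γ)) : Option (Q × (K → List Γ)) :=
  match c.2 (M.rd c.1) with
  | [] => none
  | x :: l =>
    match M.δ c.1 x with
    | none => none
    | some (u, q') => some (q', fun k => stkOf u k ++ Function.update c.2 (M.rd c.1) l k)

theorem SM.step_eq (M : SM Q K Γ) {c c' : Q × (K → List Γ)} (h : M.step c = some c') :
    ∃ x l u q', c.2 (M.rd c.1) = x :: l ∧ M.δ c.1 x = some (u, q') ∧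
      c' = (q', fun k => stkOf u k ++ Function.update c.2 (M.rd c.1) l k) := by
  unfold SM.step at h
  split at h
  · simp at h
  · rename_i x l hx
    split at h
    · simp at h
    · rename_i u q' hu
      exact ⟨x, l, u, q', hx, hu, by simpa using h.symm⟩

theorem SM.step_of (M : SM Q K Γ) (q : Q) (S : K → List Γ) (x l u q')
    (h : S (M.rd q) = x :: l) (h2 : M.δ q x = some (u, q')) :
    M.step (q, S) = some (q', fun k => stkOf u k ++ Function.update S (M.rd q) l k) := by
  simp [SM.step, h, h2]

/-- The stacks written as a word. -/
def SW (ks : List K) (S : K → List Γ) : List (Q ⊕ (K × Γ)) :=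
  ks.flatMap fun k => (S k).map fun x => Sum.inr (k, x)

/-- Defining relations of the machine semigroup. -/
inductive MRel (M : SM Q K Γ) : List (Q ⊕ (K × Γ)) → List (Q ⊕ (K × Γ)) → Prop
  | swap (k k' : K) (x y : Γ) : k ≠ k' →
      MRel M [Sum.inr (k, x), Sum.inr (k', y)] [Sum.inr (k', y), Sum.inr (k, x)]
  | step (q : Q) (x : Γ) (u : List (K × Γ)) (q' : Q) : M.δ q x = some (u, q') →
      MRel M [Sum.inl q, Sum.inr (M.rd q, x)] (Sum.inl q' :: u.map Sum.inr)

/-- The relations imposed on a family of group elements. -/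
structure Sat {G : Type*} [Group G] (M : SM Q K Γ) (qa : Q) (xa : Γ)
    (X : Fin 5 → Fin 5 → (Q ⊕ (K × Γ)) → G) : Prop where
  st : St X
  rel : ∀ u v, MRel M u v → ∀ i j, i ≠ j → XW X i j u = XW X i j v
  acc : ∀ i j, i ≠ j → XW X i j [Sum.inl qa, Sum.inr (M.rd qa, xa)] = 1

variable {G : Type*} [Group G] {M : SM Q K Γ} {qa : Q} {xa : Γ}
  {X : Fin 5 → Fin 5 → (Q ⊕ (K × Γ)) → G}

/-- Words which are interchangeable in every context. -/
def WE {A : Type*} (X : Fin 5 → Fin 5 → A → G) (u v : List A) : Prop :=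
  ∀ a b i j, i ≠ j → XW X i j (a ++ (u ++ b)) = XW X i j (a ++ (v ++ b))

theorem WE.trans {A : Type*} {X : Fin 5 → Fin 5 → A → G} {u v w : List A} (h : WE X u v)
    (h' : WE X v w) : WE X u w :=
  fun a b i j hij => (h a b i j hij).trans (h' a b i j hij)

theorem WE.symm {A : Type*} {X : Fin 5 → Fin 5 → A → G} {u v : List A} (h : WE X u v) :
    WE X v u :=
  fun a b i j hij => (h a b i j hij).symm

theorem WE.refl {A : Type*} (X : Fin 5 → Fin 5 → A → G) (u : List A) : WE X u u :=
  fun _ _ _ _ _ => rfl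

theorem WE.left {A : Type*} {X : Fin 5 → Fin 5 → A → G} {u v : List A} (h : WE X u v)
    (c : List A) : WE X (c ++ u) (c ++ v) :=
  fun a b i j hij => by simpa using h (a ++ c) b i j hij

theorem WE.right {A : Type*} {X : Fin 5 → Fin 5 → A → G} {u v : List A} (h : WE X u v)
    (c : List A) : WE X (u ++ c) (v ++ c) :=
  fun a b i j hij => by simpa using h a (c ++ b) i j hij

theorem Sat.we (h : Sat M qa xa X) {u v : List (Q ⊕ (K × Γ))} (huv : MRel M u v) : WE X u v := by
  intro a b i j hij
  refine XW_context h.st u v ?_ ?_ (h.rel u v huv) a b i j hij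
  · cases huv <;> simp
  · cases huv <;> simp

theorem Sat.swap_list (h : Sat M qa xa X) (k k' : K) (hk : k ≠ k') (x : Γ) (l : List Γ) :
    WE X (Sum.inr (k, x) :: l.map fun y => Sum.inr (k', y))
      ((l.map fun y => Sum.inr (k', y)) ++ [Sum.inr (k, x)]) := by
  induction l with
  | nil => exact WE.refl _ _
  | cons y l ih =>
    have h1 := (h.we (MRel.swap k k' x y hk)).right (l.map fun y => Sum.inr (k', y))
    have h2 := ih.left [Sum.inr (k', y)]
    exact h1.trans h2

theorem SW_update_notMem (ks : List K) (k : K) (hk : k ∉ ks) (S : K → List Γ) (l : List Γ) :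
    SW (Q := Q) ks (Function.update S k l) = SW ks S := by
  unfold SW
  refine List.flatMap_congr fun k' hk' => ?_
  rw [Function.update_of_ne]
  rintro rfl; exact hk hk'

theorem Sat.push (h : Sat M qa xa X) (ks : List K) (hks : ks.Nodup) (k : K) (hk : k ∈ ks) (x : Γ)
    (S : K → List Γ) :
    WE X (Sum.inr (k, x) :: SW ks S) (SW ks (Function.update S k (x :: S k))) := by
  induction ks with
  | nil => simp at hk
  | cons k0 ks ih =>
    rw [List.nodup_cons] at hks
    by_cases hkk : k = k0
    · subst hkk
      have : SW (Q := Q) (k :: ks) (Function.update S k (x :: S k)) =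
          Sum.inr (k, x) :: SW (k :: ks) S := by
        have := SW_update_notMem (Q := Q) ks k hks.1 S (x :: S k)
        unfold SW at this ⊢
        simp only [List.flatMap_cons, this]
        simp
      rw [this]; exact WE.refl _ _
    · have hk' : k ∈ ks := by simpa [hkk] using hk
      have h1 := (h.swap_list k k0 hkk x (S k0)).right (SW ks S)
      have h2 := (ih hks.2 hk').left ((S k0).map fun y => Sum.inr (k0, y))
      have e1 : SW (Q := Q) (k0 :: ks) S = ((S k0).map fun y => Sum.inr (k0, y)) ++ SW ks S := by
        simp [SW]
      have e2 : SW (Q := Q) (k0 :: ks) (Function.update S k (x :: S k)) =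
          ((S k0).map fun y => Sum.inr (k0, y)) ++ SW ks (Function.update S k (x :: S k)) := by
        simp [SW, Function.update_of_ne (Ne.symm hkk)]
      rw [e1, e2]
      refine WE.trans ?_ h2
      simpa using h1

theorem Sat.pushes (h : Sat M qa xa X) (ks : List K) (hks : ks.Nodup) (hk : ∀ k, k ∈ ks)
    (u : List (K × Γ)) (S : K → List Γ) :
    WE X (u.map Sum.inr ++ SW ks S) (SW ks (fun k => stkOf u k ++ S k)) := by
  induction u with
  | nil => exact WE.refl _ _
  | cons y u ih =>
    have h1 := ih.left [Sum.inr y]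
    have h2 := h.push ks hks y.1 (hk _) y.2 (fun k => stkOf u k ++ S k)
    have e : (fun k => stkOf (y :: u) k ++ S k) =
        Function.update (fun k => stkOf u k ++ S k) y.1 (y.2 :: (stkOf u y.1 ++ S y.1)) := by
      funext k
      rw [stkOf_cons]
      by_cases hy : y.1 = k
      · subst hy; simp
      · rw [Function.update_of_ne (Ne.symm hy)]; simp [hy]
    rw [e]
    exact h1.trans h2

theorem Sat.step (h : Sat M qa xa X) (ks : List K) (hks : ks.Nodup) (hk : ∀ k, k ∈ ks)
    {c c' : Q × (K → List Γ)} (hc : M.step c = some c') :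
    WE X (Sum.inl c.1 :: SW ks c.2) (Sum.inl c'.1 :: SW ks c'.2) := by
  obtain ⟨x, l, u, q', h1, h2, rfl⟩ := M.step_eq hc
  have a1 := h.push ks hks (M.rd c.1) (hk _) x (Function.update c.2 (M.rd c.1) l)
  have e : Function.update (Function.update c.2 (M.rd c.1) l) (M.rd c.1)
      (x :: Function.update c.2 (M.rd c.1) l (M.rd c.1)) = c.2 := by
    rw [Function.update_self, ← h1]; simp
  rw [e] at a1
  have a2 := (h.we (MRel.step c.1 x u q' h2)).right (SW ks (Function.update c.2 (M.rd c.1) l))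
  have a3 := (h.pushes ks hks hk u (Function.update c.2 (M.rd c.1) l)).left [Sum.inl q']
  refine ((a1.symm).left [Sum.inl c.1]).trans ?_
  refine WE.trans ?_ a3
  simpa using a2

theorem Sat.reaches (h : Sat M qa xa X) (ks : List K) (hks : ks.Nodup) (hk : ∀ k, k ∈ ks)
    {c c' : Q × (K → List Γ)} (hc : StateTransition.Reaches M.step c c') :
    WE X (Sum.inl c.1 :: SW ks c.2) (Sum.inl c'.1 :: SW ks c'.2) := by
  induction hc with
  | refl => exact WE.refl _ _
  | tail _ hb ih => exact ih.trans (h.step ks hks hk hb)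

/-- If the machine accepts, the element of the starting word is trivial. -/
theorem Sat.accept (h : Sat M qa xa X) (ks : List K) (hks : ks.Nodup) (hk : ∀ k, k ∈ ks)
    {c : Q × (K → List Γ)} {S : K → List Γ} {l : List Γ} (hS : S (M.rd qa) = xa :: l)
    (hc : StateTransition.Reaches M.step c (qa, S)) (i j : Fin 5) (hij : i ≠ j) :
    XW X i j (Sum.inl c.1 :: SW ks c.2) = 1 := by
  have a0 := h.reaches ks hks hk hc
  have a1 := h.push ks hks (M.rd qa) (hk _) xa (Function.update S (M.rd qa) l)
  have e : Function.update (Function.update S (M.rd qa) l) (M.rd qa)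
      (xa :: Function.update S (M.rd qa) l (M.rd qa)) = S := by
    rw [Function.update_self, ← hS]; simp
  rw [e] at a1
  have a2 := a0.trans ((a1.symm).left [Sum.inl qa])
  have := a2 [] [] i j hij
  simp only [List.nil_append, List.append_nil] at this
  rw [this]
  exact XW_zero h.st [Sum.inl qa, Sum.inr (M.rd qa, xa)] (by simp) h.acc _ i j hij

end machine

end Stein

namespace Stein

section pgroup
open scoped commutatorElement

/-- The multiplicative monoid `1 + I`. -/
def oneAdd {R : Type} [Ring R] (I : NonUnitalSubring R) : Submonoid R where
  carrier := {g | g - 1 ∈ I}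
  one_mem' := by simp
  mul_mem' := by
    intro a b ha hb
    have : a * b - 1 = (a - 1) * (b - 1) + (a - 1) + (b - 1) := by noncomm_ring
    rw [Set.mem_setOf_eq, this]
    exact I.add_mem (I.add_mem (I.mul_mem ha hb) ha) hb

theorem oneAdd_pow {R : Type} [Ring R] (p : ℕ) (hp : p.Prime) (hR : (p : R) = 0)
    (I : NonUnitalSubring R) (N : ℕ) (hN : ∀ a ∈ I, a ^ N = 0) (g : oneAdd I) :
    g ^ p ^ N = 1 := by
  apply Subtype.ext
  have hg : (g : R) - 1 ∈ I := g.2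
  obtain ⟨r, hr⟩ := (Commute.one_right ((g : R) - 1)).exists_add_pow_prime_pow_eq hp N
  rw [hR] at hr
  have : ((g : R) - 1) ^ p ^ N = 0 :=
    pow_eq_zero_of_le (Nat.lt_pow_self hp.one_lt).le (hN _ hg)
  simpa [this] using hr

/-- The group `1 + I` for a nil ideal in characteristic `p`. -/
@[reducible]
noncomputable def oneAddGroup {R : Type} [Ring R] (p : ℕ) (hp : p.Prime) (hR : (p : R) = 0)
    (I : NonUnitalSubring R) (N : ℕ) (hN : ∀ a ∈ I, a ^ N = 0) : Group (oneAdd I) :=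
  IsMulTorsion.group (G := oneAdd I) fun g =>
    isOfFinOrder_iff_pow_eq_one.2 ⟨p ^ N, pow_pos hp.pos N, oneAdd_pow p hp hR I N hN g⟩

theorem exists_pgroup {R : Type} [Ring R] (p : ℕ) (hp : p.Prime) (hR : (p : R) = 0)
    (I : NonUnitalSubring R) (N : ℕ) (hN : ∀ a ∈ I, a ^ N = 0) :
    ∃ (G : Type) (_ : Group G) (v : G →* R), IsPGroup p G ∧ Function.Injective v ∧
      ∀ a ∈ I, ∃ g, v g = 1 + a := by
  refine ⟨oneAdd I, oneAddGroup p hp hR I N hN, ?_⟩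
  letI := oneAddGroup p hp hR I N hN
  refine ⟨(oneAdd I).subtype, ?_, Subtype.val_injective, ?_⟩
  · intro g
    exact ⟨N, oneAdd_pow p hp hR I N hN g⟩
  · intro a ha
    exact ⟨⟨1 + a, by simpa [oneAdd] using ha⟩, rfl⟩

/-- The matrices with entries in `L`. -/
def matSub {E : Type} [Ring E] (L : NonUnitalSubring E) :
    NonUnitalSubring (Matrix (Fin 5) (Fin 5) E) where
  carrier := {a | ∀ i j, a i j ∈ L}
  zero_mem' := fun i j => by simp
  add_mem' := fun ha hb i j => L.add_mem (ha i j) (hb i j)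
  neg_mem' := fun ha i j => L.neg_mem (ha i j)
  mul_mem' := by
    intro a b ha hb i j
    rw [Matrix.mul_apply]
    exact sum_mem fun k _ => L.mul_mem (ha i k) (hb k j)

theorem comm_of_val {G R : Type} [Group G] [Ring R] (v : G →* R) (hv : Function.Injective v)
    {a b c : G} (h : v a * v b = v c * (v b * v a)) : ⁅a, b⁆ = c := by
  have : a * b = c * (b * a) := hv (by simpa using h)
  rw [commutatorElement_def, this]; group

theorem exists_model {E A : Type} [Ring E] (p : ℕ) (hp : p.Prime) (hE : (p : E) = 0)
    (L : ℕ → NonUnitalSubring E) (hL : ∀ m n a b, a ∈ L m → b ∈ L n → a * b ∈ L (m + n))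
    (N : ℕ) (hN : ∀ a ∈ L (N + 1), a = 0) (ρ : A → E) (hρ : ∀ s, ρ s ∈ L 1) :
    ∃ (G : Type) (_ : Group G) (X : Fin 5 → Fin 5 → A → G), IsPGroup p G ∧ St X ∧
      (∀ w w', w ≠ [] → w' ≠ [] → (w.map ρ).prod = (w'.map ρ).prod →
        ∀ i j, i ≠ j → XW X i j w = XW X i j w') ∧
      (∀ w, w ≠ [] → ∀ i j, i ≠ j → (XW X i j w = 1 ↔ (w.map ρ).prod = 0)) := by
  have hnil : ∀ a ∈ matSub (L 1), a ^ (N + 1) = 0 := by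
    intro a ha
    have : ∀ n i j, (a ^ (n + 1)) i j ∈ L (n + 1) := by
      intro n
      induction n with
      | zero => intro i j; simpa using ha i j
      | succ n ih =>
        intro i j
        rw [pow_succ, Matrix.mul_apply]
        exact sum_mem fun k _ => hL _ _ _ _ (ih i k) (ha k j)
    ext i j
    exact hN _ (this N i j)
  have hR : (p : Matrix (Fin 5) (Fin 5) E) = 0 := by
    rw [← map_natCast (Matrix.scalar (Fin 5)) p, hE, map_zero]
  obtain ⟨G, _, v, hG, hv, hs⟩ := exists_pgroup p hp hR (matSub (L 1)) (N + 1) hnil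
  have hmem : ∀ i j s, Matrix.single i j (ρ s) ∈ matSub (L 1) := by
    intro i j s i' j'
    rw [Matrix.single_apply]
    split
    · exact hρ s
    · exact zero_mem _
  choose X hX using fun i j s => hs _ (hmem i j s)
  have key : ∀ i j k (a b : E), i ≠ j → j ≠ k → i ≠ k → ∀ x y z : G,
      v x = 1 + Matrix.single i j a → v y = 1 + Matrix.single j k b →
      v z = 1 + Matrix.single i k (a * b) → ⁅x, y⁆ = z := by
    intro i j k a b hij hjk hik x y z hx hy hz
    apply comm_of_val v hv
    rw [hx, hy, hz]
    simp only [mul_add, add_mul, one_mul, mul_one, Matrix.single_mul_single_same,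
      Matrix.single_mul_single_of_ne _ _ _ _ hik.symm,
      Matrix.single_mul_single_of_ne _ _ _ _ hjk.symm,
      Matrix.single_mul_single_of_ne _ _ _ _ hij.symm]
    simp only [mul_zero, add_zero, Matrix.single_mul_single_of_ne _ _ _ _ hij.symm,
      Matrix.single_mul_single_of_ne _ _ _ _ hik.symm]
    abel
  have hW : ∀ w, w ≠ [] → ∀ i j, i ≠ j →
      v (XW X i j w) = 1 + Matrix.single i j (w.map ρ).prod := by
    intro w
    induction w with
    | nil => simp
    | cons s w ih =>
      intro _ i j hij
      cases w with
      | nil => simp [XW, hX]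
      | cons t w =>
        have h3 := third_ne i j
        have h4 := ih (by simp) (third i j) j h3.2
        obtain ⟨z, hz⟩ : ∃ z, v z =
            1 + Matrix.single i j (ρ s * ((t :: w).map ρ).prod) := by
          apply hs
          have : ∀ w : List A, w ≠ [] → (w.map ρ).prod ∈ L 1 := by
            intro w
            induction w with
            | nil => simp
            | cons s w ih =>
              intro _
              by_cases hw : w = []
              · subst hw; simpa using hρ s
              · simpa using (L 1).mul_mem (hρ s) (ih hw)
          have := (L 1).mul_mem (hρ s) (this (t :: w) (by simp))
          intro i' j'
          rw [Matrix.single_apply]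
          split
          · exact this
          · exact zero_mem _
        have := key i (third i j) j (ρ s) _ h3.1.symm h3.2 hij _ _ z (hX _ _ _) h4 hz
        rw [XW, this, hz]
        simp
  have hsing : ∀ (i j : Fin 5) (a b : E),
      Matrix.single i j a = Matrix.single i j b → a = b := by
    intro i j a b h
    simpa using congrFun (congrFun h i) j
  refine ⟨G, _, X, hG, ⟨?_, ?_⟩, ?_, ?_⟩
  · intro i j k l s t hij hkl hil hjk
    apply hv
    rw [map_mul, map_mul, hX, hX]
    simp only [mul_add, add_mul, one_mul, mul_one,
      Matrix.single_mul_single_of_ne _ _ _ _ hil.symm,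
      Matrix.single_mul_single_of_ne _ _ _ _ hjk]
    abel
  · intro i j l k s t hik hji hjk hli hlk
    obtain ⟨z, hz⟩ : ∃ z, v z = 1 + Matrix.single i k (ρ s * ρ t) := by
      apply hs
      have := (L 1).mul_mem (hρ s) (hρ t)
      intro i' j'
      rw [Matrix.single_apply]
      split
      · exact this
      · exact zero_mem _
    rw [key i j k _ _ hji.symm hjk hik _ _ z (hX _ _ _) (hX _ _ _) hz,
      key i l k _ _ hli.symm hlk hik _ _ z (hX _ _ _) (hX _ _ _) hz]
  · intro w w' hw hw' h i j hij
    apply hv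
    rw [hW w hw i j hij, hW w' hw' i j hij, h]
  · intro w hw i j hij
    rw [← hv.eq_iff, hW w hw i j hij, map_one]
    constructor
    · intro h
      apply hsing i j
      simpa using h
    · intro h; simp [h]

end pgroup

end Stein

namespace Stein

section model
open StateTransition
variable {Q K Γ : Type} [DecidableEq K] [Fintype K]

/-- Total length of the stacks. -/
def csize (c : Q × (K → List Γ)) : ℕ := ∑ k, (c.2 k).length

/-- Add a letter at the bottom of a stack. -/
def addBot (k : K) (x : Γ) (c : Q × (K → List Γ)) : Q × (K → List Γ) :=
  (c.1, Function.update c.2 k (c.2 k ++ [x]))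

/-- Accepting configurations. -/
def Acc (M : SM Q K Γ) (qa : Q) (xa : Γ) (c : Q × (K → List Γ)) : Prop :=
  c.1 = qa ∧ ∃ l, c.2 (M.rd qa) = xa :: l

theorem addBot_apply (k : K) (x : Γ) (c : Q × (K → List Γ)) (k' : K) :
    (addBot k x c).2 k' = c.2 k' ++ (if k = k' then [x] else []) := by
  by_cases h : k = k'
  · subst h; simp [addBot]
  · simp [addBot, h, Function.update_of_ne (Ne.symm h)]

theorem csize_addBot (k : K) (x : Γ) (c : Q × (K → List Γ)) :
    csize (addBot k x c) = csize c + 1 := by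
  unfold csize
  have : ∀ k', ((addBot k x c).2 k').length = (c.2 k').length + if k = k' then 1 else 0 := by
    intro k'
    rw [addBot_apply]
    by_cases h : k = k' <;> simp [h]
  simp only [this, Finset.sum_add_distrib]
  simp

theorem step_addBot (M : SM Q K Γ) (k : K) (x : Γ) {c c' : Q × (K → List Γ)}
    (h : M.step c = some c') : M.step (addBot k x c) = some (addBot k x c') := by
  obtain ⟨y, l, u, q', h1, h2, rfl⟩ := M.step_eq h
  have h3 : (addBot k x c).2 (M.rd c.1) = y :: (l ++ if k = M.rd c.1 then [x] else []) := by
    rw [addBot_apply, h1]; rfl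
  have := M.step_of (addBot k x c).1 (addBot k x c).2 y _ u q' h3 h2
  rw [Prod.mk.eta] at this
  rw [this]
  congr 1
  refine Prod.ext rfl (funext fun k' => ?_)
  rw [addBot_apply]
  simp only [List.append_assoc]
  congr 1
  change Function.update _ (M.rd c.1) _ k' = _
  by_cases h : k' = M.rd c.1
  · subst h; simp
  · rw [Function.update_of_ne h, Function.update_of_ne h, addBot_apply]

theorem acc_addBot (M : SM Q K Γ) (qa : Q) (xa : Γ) (k : K) (x : Γ) {c : Q × (K → List Γ)}
    (h : Acc M qa xa c) : Acc M qa xa (addBot k x c) := by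
  obtain ⟨h1, l, h2⟩ := h
  refine ⟨h1, l ++ (if k = M.rd qa then [x] else []), ?_⟩
  rw [addBot_apply, h2]
  rfl

theorem csize_step (M : SM Q K Γ) {c c' : Q × (K → List Γ)}
    (h : M.step c = some c') : csize c ≤ csize c' := by
  obtain ⟨y, l, u, q', h1, h2, rfl⟩ := M.step_eq h
  have hu := M.ne _ _ _ _ h2
  obtain ⟨z, u, rfl⟩ := List.exists_cons_of_ne_nil hu
  unfold csize
  have e1 : ∑ k, (c.2 k).length =
      ∑ k, ((Function.update c.2 (M.rd c.1) l k).length + if M.rd c.1 = k then 1 else 0) := by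
    refine Finset.sum_congr rfl fun k _ => ?_
    by_cases h : M.rd c.1 = k
    · subst h; simp [h1]
    · simp [h, Function.update_of_ne (Ne.symm h)]
  have e2 : ∑ k, ((Function.update c.2 (M.rd c.1) l k).length + if z.1 = k then 1 else 0) ≤
      ∑ k, (stkOf (z :: u) k ++ Function.update c.2 (M.rd c.1) l k).length := by
    refine Finset.sum_le_sum fun k _ => ?_
    rw [stkOf_cons]
    by_cases h : z.1 = k <;> simp [h] <;> omega
  refine le_trans (le_of_eq ?_) e2
  rw [e1]
  simp [Finset.sum_add_distrib]

theorem csize_reaches (M : SM Q K Γ) {c c' : Q × (K → List Γ)}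
    (h : Reaches M.step c c') : csize c ≤ csize c' := by
  induction h with
  | refl => exact le_rfl
  | tail _ hb ih => exact ih.trans (csize_step M hb)

variable (p : ℕ)

/-- Points of the model. -/
abbrev Pt (Q K Γ : Type) := Option (Q × (K → List Γ))

/-- Functions compatible with the machine. -/
def modW (M : SM Q K Γ) (qa : Q) (xa : Γ) (N : ℕ) : Submodule (ZMod p) (Pt Q K Γ → ZMod p) where
  carrier := {f | (∀ c c', M.step c = some c' → f (some c) = f (some c')) ∧
    (∀ c, Acc M qa xa c → f (some c) = 0) ∧ (∀ c, N < csize c → f (some c) = 0)}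
  zero_mem' := ⟨fun _ _ _ => rfl, fun _ _ => rfl, fun _ _ => rfl⟩
  add_mem' := by
    rintro f g ⟨h1, h2, h3⟩ ⟨k1, k2, k3⟩
    exact ⟨fun c c' h => by simp [h1 c c' h, k1 c c' h], fun c h => by simp [h2 c h, k2 c h],
      fun c h => by simp [h3 c h, k3 c h]⟩
  smul_mem' := by
    rintro a f ⟨h1, h2, h3⟩
    exact ⟨fun c c' h => by simp [h1 c c' h], fun c h => by simp [h2 c h],
      fun c h => by simp [h3 c h]⟩

/-- The partial map of a letter. -/
def tau : Q ⊕ (K × Γ) → Pt Q K Γ → Option (Pt Q K Γ)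
  | Sum.inl q, none => some (some (q, fun _ => []))
  | Sum.inl _, some _ => none
  | Sum.inr _, none => none
  | Sum.inr y, some c => some (some (addBot y.1 y.2 c))

/-- Pullback along the partial map of a letter. -/
def pull (s : Q ⊕ (K × Γ)) : (Pt Q K Γ → ZMod p) →ₗ[ZMod p] (Pt Q K Γ → ZMod p) where
  toFun f y := match tau s y with
    | none => 0
    | some y' => f y'
  map_add' f g := by
    funext y
    simp only [Pi.add_apply]
    split <;> simp
  map_smul' a f := by
    funext y
    simp only [Pi.smul_apply, RingHom.id_apply]
    split <;> simp

theorem pull_mem (M : SM Q K Γ) (qa : Q) (xa : Γ) (N : ℕ) (s : Q ⊕ (K × Γ))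
    (f : Pt Q K Γ → ZMod p) (hf : f ∈ modW p M qa xa N) : pull p s f ∈ modW p M qa xa N := by
  obtain ⟨h1, h2, h3⟩ := hf
  cases s with
  | inl q => exact ⟨fun _ _ _ => rfl, fun _ _ => rfl, fun _ _ => rfl⟩
  | inr y =>
    refine ⟨fun c c' h => h1 _ _ (step_addBot M y.1 y.2 h),
      fun c h => h2 _ (acc_addBot M qa xa y.1 y.2 h), fun c h => h3 _ ?_⟩
    rw [csize_addBot]; omega

/-- The operator of a letter. -/
def rho (M : SM Q K Γ) (qa : Q) (xa : Γ) (N : ℕ) (s : Q ⊕ (K × Γ)) :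
    Module.End (ZMod p) (modW p M qa xa N) :=
  (pull p s).restrict (pull_mem p M qa xa N s)

/-- The degree of a point. -/
def pdeg : Pt Q K Γ → ℕ
  | none => 0
  | some c => csize c + 1

/-- Operators lowering the filtration by `n`. -/
def lower (M : SM Q K Γ) (qa : Q) (xa : Γ) (N n : ℕ) :
    NonUnitalSubring (Module.End (ZMod p) (modW p M qa xa N)) where
  carrier := {a | ∀ r, ∀ f : modW p M qa xa N, (∀ y, r + n ≤ pdeg y → f.1 y = 0) →
    ∀ y, r ≤ pdeg y → (a f).1 y = 0}
  zero_mem' := fun r f _ y _ => by simp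
  add_mem' := fun {a b} ha hb r f hf y hy => by
    have h1 := ha r f hf y hy
    have h2 := hb r f hf y hy
    simp [h1, h2]
  neg_mem' := fun {a} ha r f hf y hy => by
    have h1 := ha r f hf y hy
    simp [h1]
  mul_mem' := fun {a b} ha hb r f hf y hy => by
    refine ha r (b f) (fun y hy => hb r f hf y (by omega)) y hy

variable {p}

theorem lower_mul (M : SM Q K Γ) (qa : Q) (xa : Γ) (N m n : ℕ) (a b)
    (ha : a ∈ lower p M qa xa N m) (hb : b ∈ lower p M qa xa N n) :
    a * b ∈ lower p M qa xa N (m + n) := by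
  intro r f hf y hy
  refine ha r (b f) (fun y hy => hb (r + m) f (fun y hy => hf y (by omega)) y hy) y hy

theorem lower_zero (M : SM Q K Γ) (qa : Q) (xa : Γ) (N : ℕ) (a)
    (ha : a ∈ lower p M qa xa N (N + 1 + 1)) : a = 0 := by
  refine LinearMap.ext fun f => Subtype.ext (funext fun y => ?_)
  refine ha 0 f (fun y hy => ?_) y (Nat.zero_le _)
  cases y with
  | none => simp [pdeg] at hy
  | some c => exact f.2.2.2 c (by simp [pdeg] at hy; omega)

theorem rho_lower (M : SM Q K Γ) (qa : Q) (xa : Γ) (N : ℕ) (s : Q ⊕ (K × Γ)) :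
    rho p M qa xa N s ∈ lower p M qa xa N 1 := by
  intro r f hf y hy
  cases s with
  | inl q =>
    cases y with
    | none =>
      refine hf _ ?_
      simp [pdeg] at hy ⊢; omega
    | some c => rfl
  | inr s =>
    cases y with
    | none => rfl
    | some c =>
      refine hf _ ?_
      simp only [pdeg, csize_addBot] at hy ⊢; omega

/-- Adding letters at the bottom of stacks. -/
theorem rho_word (M : SM Q K Γ) (qa : Q) (xa : Γ) (N : ℕ) (u : List (K × Γ)) (q : Q)
    (S : K → List Γ) (f : modW p M qa xa N) :
    (((u.map Sum.inr).map (rho p M qa xa N)).prod f).1 (some (q, S)) =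
      f.1 (some (q, fun k => S k ++ stkOf u k)) := by
  induction u generalizing S with
  | nil => simp [stkOf_nil]
  | cons y u ih =>
    simp only [List.map_cons, List.prod_cons]
    change (((u.map Sum.inr).map (rho p M qa xa N)).prod f).1 (some (addBot y.1 y.2 (q, S))) = _
    have := ih (addBot y.1 y.2 (q, S)).2
    refine this.trans ?_
    refine congrArg (fun T => f.1 (some (q, T))) ?_
    funext k
    rw [addBot_apply, stkOf_cons]
    by_cases h : y.1 = k <;> simp [h]

theorem rho_state_word (M : SM Q K Γ) (qa : Q) (xa : Γ) (N : ℕ) (u : List (K × Γ)) (q : Q)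
    (f : modW p M qa xa N) (y : Pt Q K Γ) :
    (((Sum.inl q :: u.map Sum.inr).map (rho p M qa xa N)).prod f).1 y =
      match y with
      | none => f.1 (some (q, stkOf u))
      | some _ => 0 := by
  cases y with
  | some c => rfl
  | none =>
    have := rho_word M qa xa N u q (fun _ => []) f
    simp only [List.nil_append] at this
    exact this

theorem stkOf_SW (ks : List K) (hks : ks.Nodup) (S : K → List Γ) :
    ∃ u : List (K × Γ), SW (Q := Q) ks S = u.map Sum.inr ∧
      ∀ k, stkOf u k = if k ∈ ks then S k else [] := by
  induction ks with
  | nil => exact ⟨[], rfl, fun k => by simp [stkOf_nil]⟩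
  | cons k0 ks ih =>
    rw [List.nodup_cons] at hks
    obtain ⟨u, h1, h2⟩ := ih hks.2
    refine ⟨(S k0).map (fun x => (k0, x)) ++ u, ?_, ?_⟩
    · rw [List.map_append, ← h1]; simp [SW]
    · intro k
      have : stkOf ((S k0).map (fun x => (k0, x)) ++ u) k =
          (if k0 = k then S k0 else []) ++ stkOf u k := by
        unfold stkOf
        rw [List.filterMap_append, List.filterMap_map]
        by_cases h : k0 = k <;> simp [h, Function.comp_def]
      rw [this, h2]
      by_cases h : k0 = k
      · subst h; simp [hks.1]
      · simp [h, Ne.symm h]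

/-- If the machine halts without accepting, there is a `p`-group in which the relations hold
and the element of the starting word is non-trivial. -/
theorem reject_model (hp : p.Prime) (M : SM Q K Γ) (qa : Q) (xa : Γ) (hqa : M.δ qa xa = none)
    (ks : List K) (hks : ks.Nodup) (hk : ∀ k, k ∈ ks) {c cf : Q × (K → List Γ)}
    (hc : Reaches M.step c cf) (hcf : M.step cf = none) (hna : ¬ Acc M qa xa cf) :
    ∃ (G : Type) (_ : Group G) (X : Fin 5 → Fin 5 → (Q ⊕ (K × Γ)) → G), IsPGroup p G ∧
      Sat M qa xa X ∧ ∀ i j, i ≠ j → XW X i j (Sum.inl c.1 :: SW ks c.2) ≠ 1 := by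
  classical
  set N := csize cf with hN
  have hE : (p : Module.End (ZMod p) (modW p M qa xa N)) = 0 := by
    refine LinearMap.ext fun f => Subtype.ext (funext fun y => ?_)
    simp
  obtain ⟨G, _, X, hG, hst, hX1, hX2⟩ := exists_model p hp hE (lower p M qa xa N)
    (lower_mul M qa xa N) (N + 1) (lower_zero M qa xa N) (rho p M qa xa N) (rho_lower M qa xa N)
  refine ⟨G, _, X, hG, ⟨hst, ?_, ?_⟩, ?_⟩
  · intro u v huv i j hij
    refine hX1 u v ?_ ?_ ?_ i j hij
    · cases huv <;> simp
    · cases huv <;> simp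
    · refine LinearMap.ext fun f => Subtype.ext (funext fun y => ?_)
      cases huv with
      | swap k k' x z hkk =>
        cases y with
        | none => rfl
        | some d =>
          have e1 := rho_word M qa xa N [(k, x), (k', z)] d.1 d.2 f
          have e2 := rho_word M qa xa N [(k', z), (k, x)] d.1 d.2 f
          refine e1.trans (Eq.trans ?_ e2.symm)
          refine congrArg (fun T => f.1 (some (d.1, T))) ?_
          funext k2
          simp only [stkOf_cons, stkOf_nil]
          by_cases h1 : k = k2
          · subst h1; simp [Ne.symm hkk]
          · simp [h1]
      | step q x u q' h =>
        have e1 := rho_state_word M qa xa N [(M.rd q, x)] q f y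
        have e2 := rho_state_word M qa xa N u q' f y
        refine e1.trans (Eq.trans ?_ e2.symm)
        cases y with
        | some d => rfl
        | none =>
          refine f.2.1 _ _ ?_
          rw [M.step_of q _ x [] u q' (by simp [stkOf_cons, stkOf_nil]) h]
          congr 2
          funext k
          by_cases h : M.rd q = k
          · subst h; simp
          · simp [Function.update_of_ne (Ne.symm h), stkOf_cons, stkOf_nil, h]
  · intro i j hij
    rw [hX2 _ (by simp) i j hij]
    refine LinearMap.ext fun f => Subtype.ext (funext fun y => ?_)
    refine (rho_state_word M qa xa N [(M.rd qa, xa)] qa f y).trans ?_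
    cases y with
    | some d => rfl
    | none => exact f.2.2.1 _ ⟨rfl, [], by simp [stkOf_cons, stkOf_nil]⟩
  · intro i j hij h1
    rw [hX2 _ (by simp) i j hij] at h1
    have hacc : ∀ d, Acc M qa xa d → M.step d = none := by
      rintro ⟨q, S⟩ ⟨h1, l, h2⟩
      simp only at h1 h2
      subst h1
      simp [SM.step, h2, hqa]
    have hterm : ∀ d, M.step d = none → Reaches M.step d cf → d = cf := by
      intro d hd hr
      rcases Relation.ReflTransGen.cases_head hr with h | ⟨e, he, _⟩
      · exact h
      · rw [hd] at he; simp at he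
    let D : modW p M qa xa N := ⟨fun y => match y with
      | none => 0
      | some d => if Reaches M.step d cf then 1 else 0, by
        refine ⟨?_, ?_, ?_⟩
        · intro d d' hd
          have : Reaches M.step d cf ↔ Reaches M.step d' cf := by
            constructor
            · intro h
              rcases Relation.ReflTransGen.cases_head h with h | ⟨e, he, h⟩
              · subst h; rw [hcf] at hd; simp at hd
              · have : e = d' := by
                  rw [hd] at he; simpa using he.symm
                exact this ▸ h
            · intro h
              exact Relation.ReflTransGen.head (by simpa using hd) h
          simp only [this]
        · intro d hd
          simp only
          rw [if_neg]
          intro h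
          exact hna (hterm d (hacc d hd) h ▸ hd)
        · intro d hd
          simp only
          rw [if_neg]
          intro h
          have := csize_reaches M h
          omega⟩
    obtain ⟨u, hu1, hu2⟩ := stkOf_SW (Q := Q) ks hks c.2
    rw [hu1] at h1
    have h2 := rho_state_word M qa xa N u c.1 D none
    rw [h1] at h2
    have h3 : stkOf u = c.2 := by funext k; rw [hu2, if_pos (hk k)]
    simp only [h3] at h2
    have h4 : D.1 (some (c.1, c.2)) = 1 := if_pos hc
    rw [h4] at h2
    haveI := Fact.mk hp
    exact zero_ne_one h2

end model

end Stein

namespace Stein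

section restrict
open StateTransition
variable {Q K Γ : Type} [DecidableEq K]

open scoped Classical in
/-- Restriction of a machine to a set of states. -/
noncomputable def SM.restrict (M : SM Q K Γ) (T : Set Q) : SM T K Γ where
  rd q := M.rd q
  δ q x := match M.δ q x with
    | none => none
    | some (u, q') => if h : q' ∈ T then some (u, ⟨q', h⟩) else none
  ne := by
    intro q x u q' h
    split at h
    · simp at h
    · rename_i u' q'' h'
      split at h
      · simp only [Option.some.injEq, Prod.mk.injEq] at h
        exact h.1 ▸ M.ne _ _ _ _ h'
      · simp at h

theorem SM.restrict_reaches (M : SM Q K Γ) (T : Set Q)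
    (hT : ∀ q ∈ T, ∀ x u q', M.δ q x = some (u, q') → q' ∈ T)
    {c c' : Q × (K → List Γ)} (h : Reaches M.step c c') (hc : c.1 ∈ T) :
    ∃ hc' : c'.1 ∈ T, Reaches (M.restrict T).step (⟨c.1, hc⟩, c.2) (⟨c'.1, hc'⟩, c'.2) := by
  induction h with
  | refl => exact ⟨hc, Relation.ReflTransGen.refl⟩
  | tail _ hb ih =>
    obtain ⟨hb', h2⟩ := ih
    obtain ⟨x, l, u, q', h3, h4, rfl⟩ := M.step_eq hb
    refine ⟨hT _ hb' _ _ _ h4, h2.tail ?_⟩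
    refine (M.restrict T).step_of _ _ x l u _ h3 ?_
    simp [SM.restrict, h4, hT _ hb' _ _ _ h4]

end restrict

section tm
open StateTransition Turing
variable {K Γ Λ σ : Type}

/-- The stack read by a statement. -/
def tmRd (main : K) : TM2.Stmt (fun _ : K => Γ) Λ σ → Option K
  | .push k _ _ => some k
  | .peek k _ _ => some k
  | .pop k _ _ => some k
  | _ => some main

/-- The transitions of the machine simulating a TM2 program. -/
def tmDelta (main : K) (P : Λ → TM2.Stmt (fun _ : K => Γ) Λ σ) :
    TM2.Stmt (fun _ : K => Γ) Λ σ → σ → Option Γ →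
      Option (List (Option K × Option Γ) × (TM2.Stmt (fun _ : K => Γ) Λ σ × σ))
  | .push k f q, v, x => some ([(some k, some (f v)), (some k, x), (none, none)], (q, v))
  | .peek k f q, v, x => some ([(some k, x), (none, none)], (q, f v x))
  | .pop k f q, v, none => some ([(some k, none), (none, none)], (q, f v none))
  | .pop _ f q, v, some a => some ([(none, none)], (q, f v (some a)))
  | .load a q, v, x => some ([(some main, x), (none, none)], (q, a v))
  | .branch f q₁ q₂, v, x => some ([(some main, x), (none, none)], (cond (f v) q₁ q₂, v))
  | .goto l, v, x => some ([(some main, x), (none, none)], (P (l v), v))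
  | .halt, _, _ => none

/-- The machine simulating a TM2 program. -/
def tmSM (main : K) (P : Λ → TM2.Stmt (fun _ : K => Γ) Λ σ) :
    SM (TM2.Stmt (fun _ : K => Γ) Λ σ × σ) (Option K) (Option Γ) where
  rd q := tmRd main q.1
  δ q x := tmDelta main P q.1 q.2 x
  ne := by
    rintro ⟨q, v⟩ x u q' h
    rcases q with _ | _ | _ | _ | _ | _ | _ <;> rcases x with _ | x <;>
      simp only [tmDelta, Option.some.injEq, Prod.mk.injEq, reduceCtorEq] at h <;>
      rw [← h.1] <;> simp

/-- Representation of stacks with a bottom marker. -/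
def Rep (S : K → List Γ) (T : Option K → List (Option Γ)) : Prop :=
  ∀ k, T (some k) = (S k).map some ++ [none]

/-- The statement of a label. -/
def stmtOf (P : Λ → TM2.Stmt (fun _ : K => Γ) Λ σ) : Option Λ → TM2.Stmt (fun _ : K => Γ) Λ σ
  | none => .halt
  | some l => P l

variable [DecidableEq K]

theorem reach_head {α : Type} {f : α → Option α} {a b c : α} (h : f a = some b)
    (h' : Reaches f b c) : Reaches f a c :=
  Relation.ReflTransGen.head h h'

theorem tm_keep (main : K) (P : Λ → TM2.Stmt (fun _ : K => Γ) Λ σ) (q q' : TM2.Stmt _ Λ σ)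
    (v v' : σ) (S : K → List Γ) (T : Option K → List (Option Γ)) (k : K) (hT : Rep S T)
    (hrd : tmRd main q = some k)
    (h : tmDelta main P q v (S k).head? = some ([(some k, (S k).head?), (none, none)], (q', v'))) :
    ∃ T', Rep S T' ∧ (tmSM main P).step ((q, v), T) = some ((q', v'), T') := by
  have h1 : ∃ l, T (some k) = (S k).head? :: l := by
    rw [hT k]
    cases S k <;> simp
  obtain ⟨l, hl⟩ := h1
  refine ⟨_, ?_, (tmSM main P).step_of (q, v) T (S k).head? l _ _
    (by simp only [tmSM, hrd, hl]) h⟩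
  intro k'
  rw [← hT k']
  simp only [tmSM, hrd]
  by_cases hk : k = k'
  · subst hk
    simp [stkOf_cons, stkOf_nil, hl]
  · simp [stkOf_cons, stkOf_nil, hk, Function.update_of_ne, Ne.symm hk]

theorem tm_sim (main : K) (P : Λ → TM2.Stmt (fun _ : K => Γ) Λ σ) (q : TM2.Stmt (fun _ : K => Γ) Λ σ)
    (v : σ) (S : K → List Γ) (T : Option K → List (Option Γ)) (hT : Rep S T) :
    ∃ T', Rep (TM2.stepAux q v S).stk T' ∧ Reaches (tmSM main P).step ((q, v), T)
      ((stmtOf P (TM2.stepAux q v S).l, (TM2.stepAux q v S).var), T') := by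
  induction q generalizing v S T with
  | push k f q ih =>
    have h1 : ∃ x l, T (some k) = x :: l := by
      rw [hT k]
      cases S k <;> simp
    obtain ⟨x, l, hl⟩ := h1
    have h2 := (tmSM main P).step_of (.push k f q, v) T x l
      [(some k, some (f v)), (some k, x), (none, none)] (q, v) hl rfl
    obtain ⟨T', h3, h4⟩ := ih v (Function.update S k (f v :: S k))
      (fun k' => stkOf [(some k, some (f v)), (some k, x), (none, none)] k' ++
          Function.update T (some k) l k') (by
      intro k'
      by_cases hk : k = k'
      · subst hk
        simp [stkOf_cons, stkOf_nil, ← hT k, hl]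
      · simp [stkOf_cons, stkOf_nil, hk, Function.update_of_ne, Ne.symm hk, hT k'])
    exact ⟨T', h3, reach_head h2 h4⟩
  | peek k f q ih =>
    obtain ⟨T1, h1, h2⟩ := tm_keep main P (.peek k f q) q v (f v (S k).head?) S T k hT rfl rfl
    obtain ⟨T', h3, h4⟩ := ih (f v (S k).head?) S T1 h1
    exact ⟨T', h3, reach_head h2 h4⟩
  | pop k f q ih =>
    cases hS : S k with
    | nil =>
      obtain ⟨T1, h1, h2⟩ := tm_keep main P (.pop k f q) q v (f v (S k).head?) S T k hT rfl
        (by rw [hS]; rfl)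
      obtain ⟨T', h3, h4⟩ := ih (f v (S k).head?) S T1 h1
      have : Function.update S k (S k).tail = S := by
        funext k'
        by_cases hk : k' = k
        · subst hk; simp [hS]
        · simp [Function.update_of_ne hk]
      have e : TM2.stepAux (.pop k f q) v S = TM2.stepAux q (f v (S k).head?) S := by
        rw [TM2.stepAux, this]
      rw [e]
      exact ⟨T', h3, reach_head h2 h4⟩
    | cons a s =>
      have hl : T (some k) = some a :: (s.map some ++ [none]) := by rw [hT k, hS]; rfl
      have h2 := (tmSM main P).step_of (.pop k f q, v) T (some a) (s.map some ++ [none])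
        [(none, none)] (q, f v (some a)) hl rfl
      obtain ⟨T', h3, h4⟩ := ih (f v (some a)) (Function.update S k s)
        (fun k' => stkOf [(none, none)] k' ++
          Function.update T (some k) (s.map some ++ [none]) k') (by
        intro k'
        by_cases hk : k = k'
        · subst hk
          simp [stkOf_cons, stkOf_nil]
        · simp [stkOf_cons, stkOf_nil, Function.update_of_ne, Ne.symm hk, hT k'])
      have e : TM2.stepAux (.pop k f q) v S =
          TM2.stepAux q (f v (some a)) (Function.update S k s) := by
        rw [TM2.stepAux, hS]; rfl
      rw [e]
      exact ⟨T', h3, reach_head h2 h4⟩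
  | load a q ih =>
    obtain ⟨T1, h1, h2⟩ := tm_keep main P (.load a q) q v (a v) S T main hT rfl rfl
    obtain ⟨T', h3, h4⟩ := ih (a v) S T1 h1
    exact ⟨T', h3, reach_head h2 h4⟩
  | branch f q₁ q₂ ih1 ih2 =>
    obtain ⟨T1, h1, h2⟩ := tm_keep main P (.branch f q₁ q₂) (cond (f v) q₁ q₂) v v S T main hT
      rfl rfl
    cases hf : f v with
    | true =>
      rw [hf] at h2
      obtain ⟨T', h3, h4⟩ := ih1 v S T1 h1
      have e : TM2.stepAux (.branch f q₁ q₂) v S = TM2.stepAux q₁ v S := by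
        rw [TM2.stepAux, hf]; rfl
      rw [e]
      exact ⟨T', h3, reach_head h2 h4⟩
    | false =>
      rw [hf] at h2
      obtain ⟨T', h3, h4⟩ := ih2 v S T1 h1
      have e : TM2.stepAux (.branch f q₁ q₂) v S = TM2.stepAux q₂ v S := by
        rw [TM2.stepAux, hf]; rfl
      rw [e]
      exact ⟨T', h3, reach_head h2 h4⟩
  | goto l =>
    obtain ⟨T1, h1, h2⟩ := tm_keep main P (.goto l) (P (l v)) v v S T main hT rfl rfl
    exact ⟨T1, h1, Relation.ReflTransGen.single h2⟩
  | halt => exact ⟨T, hT, Relation.ReflTransGen.refl⟩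

theorem tm_sim_reaches (main : K) (P : Λ → TM2.Stmt (fun _ : K => Γ) Λ σ)
    {c c' : TM2.Cfg (fun _ : K => Γ) Λ σ} (h : Reaches (TM2.step P) c c')
    (T : Option K → List (Option Γ)) (hT : Rep c.stk T) :
    ∃ T', Rep c'.stk T' ∧ Reaches (tmSM main P).step ((stmtOf P c.l, c.var), T)
      ((stmtOf P c'.l, c'.var), T') := by
  induction h with
  | refl => exact ⟨T, hT, Relation.ReflTransGen.refl⟩
  | @tail b d _ hb ih =>
    obtain ⟨T1, h1, h2⟩ := ih
    obtain ⟨l, v, S⟩ := b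
    cases l with
    | none => simp at hb
    | some l =>
      simp only [TM2.step, Option.mem_def, Option.some.injEq] at hb
      subst hb
      obtain ⟨T', h3, h4⟩ := tm_sim main P (P l) v S T1 h1
      exact ⟨T', h3, Relation.ReflTransGen.trans h2 h4⟩

open PartrecToTM2 in
theorem exists_machine (c : ToPartrec.Code) :
    ∃ (Q : Type) (_ : Finite Q) (M : SM Q (Option K') (Option Γ')) (q0 qa : Q),
      (∀ x, M.δ qa x = none) ∧ M.rd qa = some K'.main ∧
      ∀ v w, w ∈ c.eval v → ∃ T, T (some K'.main) = (trList w).map some ++ [none] ∧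
        Reaches M.step (q0, fun k => match k with
          | none => []
          | some K'.main => (trList v).map some ++ [none]
          | some _ => [none]) (qa, T) := by
  classical
  let S := codeSupp c Cont'.halt
  have hS := tr_supports c Cont'.halt
  letI : Inhabited Λ' := ⟨trNormal c Cont'.halt⟩
  let st : Finset (TM2.Stmt (fun _ : K' => Γ') Λ' (Option Γ')) :=
    insert .halt (S.biUnion fun q => TM2.stmts₁ (tr q))
  let Q0 := TM2.Stmt (fun _ : K' => Γ') Λ' (Option Γ') × Option Γ'
  let TT : Set Q0 := {q | q.1 ∈ st}
  have hmem : ∀ l, l ∈ S → tr l ∈ st := fun l hl =>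
    Finset.mem_insert_of_mem (Finset.mem_biUnion.2 ⟨l, hl, TM2.stmts₁_self⟩)
  have hfin : Finite TT := by
    have : Finite (Option Γ') := inferInstance
    letI : Fintype (Option Γ') := Fintype.ofFinite _
    refine ((st ×ˢ (Finset.univ : Finset (Option Γ'))).finite_toSet.subset ?_).to_subtype
    rintro ⟨q, v⟩ hq
    exact Finset.mem_coe.2 (Finset.mem_product.2 ⟨hq, Finset.mem_univ _⟩)
  have hsub : ∀ q ∈ st, ∀ q', q' ∈ TM2.stmts₁ q → q' ∈ st := by
    intro q hq q' hq'
    rcases Finset.mem_insert.1 hq with rfl | hq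
    · simp only [TM2.stmts₁, Finset.mem_singleton] at hq'
      subst hq'; exact Finset.mem_insert_self _ _
    · obtain ⟨l, hl, h⟩ := Finset.mem_biUnion.1 hq
      exact Finset.mem_insert_of_mem (Finset.mem_biUnion.2 ⟨l, hl, TM2.stmts₁_trans h hq'⟩)
  have hsupp : ∀ q ∈ st, TM2.SupportsStmt S q := by
    intro q hq
    rcases Finset.mem_insert.1 hq with rfl | hq
    · trivial
    · obtain ⟨l, hl, h⟩ := Finset.mem_biUnion.1 hq
      exact TM2.stmts₁_supportsStmt_mono h (hS.2 l hl)
  have hclosed : ∀ q ∈ TT, ∀ x u q', (tmSM K'.main tr).δ q x = some (u, q') → q' ∈ TT := by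
    rintro ⟨q, v⟩ hq x u q' h
    have h1 := hsub q hq
    have h2 := hsupp q hq
    change q'.1 ∈ st
    change tmDelta K'.main tr q v x = some (u, q') at h
    rcases q with ⟨k, f, q⟩ | ⟨k, f, q⟩ | ⟨k, f, q⟩ | ⟨a, q⟩ | ⟨f, q₁, q₂⟩ | l | _
    case branch =>
      simp only [tmDelta, Option.some.injEq, Prod.mk.injEq] at h
      rw [← h.2]
      cases hf : f v
      · refine h1 _ ?_
        simp [TM2.stmts₁, TM2.stmts₁_self]
      · refine h1 _ ?_
        simp [TM2.stmts₁, TM2.stmts₁_self]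
    case goto =>
      simp only [tmDelta, Option.some.injEq, Prod.mk.injEq] at h
      rw [← h.2]
      exact hmem _ (h2 v)
    case halt => simp [tmDelta] at h
    all_goals
      refine h1 _ ?_
      rcases x with _ | x <;>
        simp only [tmDelta, Option.some.injEq, Prod.mk.injEq] at h <;>
        rw [← h.2] <;> simp [TM2.stmts₁, TM2.stmts₁_self]
  have hq0 : (tr (trNormal c Cont'.halt), none) ∈ TT := hmem _ hS.1
  have hqa : ((TM2.Stmt.halt : TM2.Stmt (fun _ : K' => Γ') Λ' (Option Γ')), none) ∈ TT :=
    Finset.mem_insert_self _ _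
  refine ⟨TT, hfin, (tmSM K'.main tr).restrict TT, ⟨_, hq0⟩, ⟨_, hqa⟩, fun x => rfl, rfl, ?_⟩
  intro v w hw
  have h1 : halt w ∈ eval (TM2.step tr) (init c v) := by
    rw [PartrecToTM2.tr_eval]
    exact Part.mem_map _ hw
  obtain ⟨T, h2, h3⟩ := tm_sim_reaches K'.main tr (StateTransition.mem_eval.1 h1).1
    (fun k => match k with
          | none => []
          | some K'.main => (trList v).map some ++ [none]
          | some _ => [none]) (by intro k; cases k <;> rfl)
  obtain ⟨_, h4⟩ := SM.restrict_reaches _ TT hclosed h3 hq0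
  exact ⟨T, h2 K'.main, h4⟩

end tm

end Stein

namespace Stein

section diag
open Turing

/-- The diagonal partial function. -/
noncomputable def Hdiag (n : ℕ) : Part ℕ :=
  (Denumerable.ofNat Nat.Partrec.Code n).eval n

theorem Hdiag_partrec : Partrec Hdiag :=
  Nat.Partrec.Code.eval_part.comp (Computable.ofNat Nat.Partrec.Code) Computable.id

theorem no_sep (g : ℕ → Bool) (hg : Computable g)
    (h1 : ∀ n, 1 ∈ Hdiag n → g n = true) (h0 : ∀ n, 0 ∈ Hdiag n → g n = false) : False := by
  have hc : Computable fun n => cond (g n) 0 1 :=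
    Computable.cond hg (Computable.const 0) (Computable.const 1)
  obtain ⟨c, hc⟩ := Nat.Partrec.Code.exists_code.1 (Partrec.nat_iff.1 hc.partrec)
  have e : Hdiag (Encodable.encode c) = Part.some (cond (g (Encodable.encode c)) 0 1) := by
    rw [Hdiag, Denumerable.ofNat_encode, hc]
    rfl
  cases hgc : g (Encodable.encode c) with
  | true =>
    rw [hgc] at e
    have := h0 _ (by rw [e]; exact Part.mem_some _)
    rw [hgc] at this
    simp at this
  | false =>
    rw [hgc] at e
    have := h1 _ (by rw [e]; exact Part.mem_some _)
    rw [hgc] at this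
    simp at this

theorem primrec_pow4 : Primrec fun n : ℕ => 4 ^ n := by
  have : Primrec fun n : ℕ => n.rec (motive := fun _ => ℕ) 1 fun _ r => r * 4 :=
    Primrec.nat_rec₁ 1 (Primrec.nat_mul.comp Primrec.snd (Primrec.const 4))
  refine this.of_eq fun n => ?_
  induction n with
  | zero => rfl
  | succ n ih => simp only [ih, pow_succ]

theorem exists_diag_code :
    ∃ c : ToPartrec.Code, ∀ n k, k ∈ Hdiag n → [k] ∈ c.eval [4 ^ n] := by
  have h1 : Partrec fun m : ℕ => Nat.rfind fun k => Part.some (decide (4 ^ k = m)) := by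
    refine Partrec.rfind ?_
    have : PrimrecRel fun (m k : ℕ) => 4 ^ k = m :=
      Primrec.eq.comp (primrec_pow4.comp Primrec.snd) Primrec.fst
    exact this.decide.to_comp.partrec
  have h2 : Partrec fun m : ℕ => (Nat.rfind fun k => Part.some (decide (4 ^ k = m))).bind Hdiag :=
    h1.bind (Hdiag_partrec.comp Computable.snd)
  obtain ⟨c, hc⟩ := ToPartrec.Code.exists_code (Nat.Partrec'.part_iff₁.2 h2)
  refine ⟨c, fun n k hk => ?_⟩
  have := hc (List.Vector.cons (4 ^ n) List.Vector.nil)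
  rw [List.Vector.head_cons] at this
  change c.eval [4 ^ n] = _ at this
  rw [this]
  refine Part.mem_map (pure : ℕ → List ℕ) ?_
  refine Part.mem_bind (a := n) ?_ hk
  refine Nat.mem_rfind.2 ⟨by simp, fun {m} hm => ?_⟩
  simp only [Part.mem_some_iff]
  refine Eq.symm (decide_eq_false ?_)
  intro h
  have := Nat.pow_right_injective (le_refl 2 |>.trans (by norm_num) : 2 ≤ 4) h
  omega

open PartrecToTM2 in
theorem trNat_pow4 (n : ℕ) : trNat (4 ^ n) = List.replicate (2 * n) Γ'.bit0 ++ [Γ'.bit1] := by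
  have key : ∀ m : ℕ, ∃ q : PosNum, ((2 ^ m : ℕ) : Num) = Num.pos q ∧
      trPosNum q = List.replicate m Γ'.bit0 ++ [Γ'.bit1] := by
    intro m
    induction m with
    | zero => exact ⟨PosNum.one, by simp; rfl, rfl⟩
    | succ m ih =>
      obtain ⟨q, h1, h2⟩ := ih
      refine ⟨PosNum.bit0 q, ?_, ?_⟩
      · have : ((2 ^ (m + 1) : ℕ) : Num) = ((2 ^ m : ℕ) : Num) + ((2 ^ m : ℕ) : Num) := by
          rw [← Nat.cast_add, pow_succ]
          congr 1
          omega
        rw [this, h1, Num.bit0_of_bit0]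
        rfl
      · simp [trPosNum, h2, List.replicate_succ]
  obtain ⟨q, h1, h2⟩ := key (2 * n)
  have : (4 : ℕ) ^ n = 2 ^ (2 * n) := by rw [pow_mul]; norm_num
  rw [this, trNat, h1]
  exact h2

end diag

end Stein

namespace Stein

section formulas
open FirstOrder.Language
open scoped commutatorElement

/-- Terms in `N` variables. -/
abbrev Tm (N : ℕ) := grpLang.Term (Empty ⊕ Fin N)

/-- The value of a term. -/
def tval {N : ℕ} {G : Type} [Group G] (t : Tm N) (x : Fin N → G) : G :=
  t.realize (Sum.elim (default : Empty → G) x)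

def tvar {N : ℕ} (i : Fin N) : Tm N := Term.var (Sum.inr i)

def tone {N : ℕ} : Tm N := Term.func (l := 0) (show grpLang.Functions 0 from ()) ![]

def tinv {N : ℕ} (t : Tm N) : Tm N := Term.func (l := 1) (show grpLang.Functions 1 from ()) ![t]

def tmul {N : ℕ} (s t : Tm N) : Tm N := Term.func (l := 2) (show grpLang.Functions 2 from ()) ![s, t]

def tcomm {N : ℕ} (s t : Tm N) : Tm N := tmul (tmul (tmul s t) (tinv s)) (tinv t)

variable {N : ℕ} {G : Type} [Group G] (x : Fin N → G)

theorem tval_var (i : Fin N) : tval (tvar i) x = x i := rfl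

theorem tval_one : tval tone x = 1 := rfl

theorem tval_inv (t : Tm N) : tval (tinv t) x = (tval t x)⁻¹ := rfl

theorem tval_mul (s t : Tm N) : tval (tmul s t) x = tval s x * tval t x := rfl

theorem tval_comm (s t : Tm N) : tval (tcomm s t) x = ⁅tval s x, tval t x⁆ := rfl

/-- The term of a word. -/
def tXW {A : Type} (e : Fin 5 × Fin 5 × A → Fin N) : Fin 5 → Fin 5 → List A → Tm N
  | _, _, [] => tone
  | i, j, [s] => tvar (e (i, j, s))
  | i, j, s :: t :: w => tcomm (tvar (e (i, third i j, s))) (tXW e (third i j) j (t :: w))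

theorem tval_tXW {A : Type} (e : Fin 5 × Fin 5 × A → Fin N) (i j : Fin 5) (w : List A) :
    tval (tXW e i j w) x = XW (fun i j s => x (e (i, j, s))) i j w := by
  induction w generalizing i with
  | nil => rfl
  | cons s w ih =>
    cases w with
    | nil => rfl
    | cons t w => rw [tXW, tval_comm, ih, XW, tval_var]

/-- Predicates expressible by quantifier-free formulas. -/
def Dfn (N : ℕ) (P : ∀ (G : Type) [Group G], (Fin N → G) → Prop) : Prop :=
  ∃ ψ : grpLang.BoundedFormula Empty N, ψ.IsQF ∧
    ∀ (G : Type) [Group G] (x : Fin N → G), ψ.Realize (default : Empty → G) x ↔ P G x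

theorem Dfn.eq (s t : Tm N) : Dfn N fun _ _ x => tval s x = tval t x :=
  ⟨s.bdEqual t, (BoundedFormula.IsAtomic.equal s t).isQF,
    fun _ _ _ => BoundedFormula.realize_bdEqual s t⟩

theorem Dfn.true : Dfn N fun _ _ _ => True :=
  ⟨⊤, BoundedFormula.IsQF.top, fun _ _ _ => by simp⟩

theorem Dfn.and {P P' : ∀ (G : Type) [Group G], (Fin N → G) → Prop} (h : Dfn N P)
    (h' : Dfn N P') : Dfn N fun G _ x => P G x ∧ P' G x := by
  obtain ⟨ψ, h1, h2⟩ := h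
  obtain ⟨ψ', h1', h2'⟩ := h'
  exact ⟨ψ ⊓ ψ', h1.inf h1', fun G _ x => by rw [BoundedFormula.realize_inf, h2, h2']⟩

theorem Dfn.congr {P P' : ∀ (G : Type) [Group G], (Fin N → G) → Prop} (h : Dfn N P)
    (h' : ∀ (G : Type) [Group G] (x : Fin N → G), P G x ↔ P' G x) : Dfn N P' := by
  obtain ⟨ψ, h1, h2⟩ := h
  exact ⟨ψ, h1, fun G _ x => (h2 G x).trans (h' G x)⟩

theorem Dfn.cond {P : ∀ (G : Type) [Group G], (Fin N → G) → Prop} (c : Prop) (h : c → Dfn N P) :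
    Dfn N fun G _ x => c → P G x := by
  by_cases hc : c
  · exact (h hc).congr fun G _ x => by simp [hc]
  · exact Dfn.true.congr fun G _ x => by simp [hc]

theorem Dfn.all {ι : Type} [Finite ι] {P : ι → ∀ (G : Type) [Group G], (Fin N → G) → Prop}
    (h : ∀ i, Dfn N (P i)) : Dfn N fun G _ x => ∀ i, P i G x := by
  classical
  haveI := Fintype.ofFinite ι
  have : ∀ s : Finset ι, Dfn N fun G _ x => ∀ i ∈ s, P i G x := by
    intro s
    induction s using Finset.induction_on with
    | empty => exact Dfn.true.congr fun G _ x => by simp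
    | insert i s _ ih => exact ((h i).and ih).congr fun G _ x => by simp
  exact (this Finset.univ).congr fun G _ x => by simp

theorem Dfn.sat {Q K Γ : Type} [Finite Q] [Finite K] [Finite Γ] (M : SM Q K Γ) (qa : Q) (xa : Γ)
    (e : Fin 5 × Fin 5 × (Q ⊕ (K × Γ)) → Fin N) :
    Dfn N fun _ _ x => Sat M qa xa fun i j s => x (e (i, j, s)) := by
  have hW : ∀ i j w i' j' w', Dfn N fun _ _ x =>
      XW (fun i j s => x (e (i, j, s))) i j w = XW (fun i j s => x (e (i, j, s))) i' j' w' := by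
    intro i j w i' j' w'
    exact (Dfn.eq (tXW e i j w) (tXW e i' j' w')).congr fun G _ x => by simp only [tval_tXW]
  have h1 : Dfn N fun _ _ x => ∀ i j k l s t, i ≠ j → k ≠ l → i ≠ l → j ≠ k →
      Commute (x (e (i, j, s))) (x (e (k, l, t))) :=
    Dfn.all fun i => Dfn.all fun j => Dfn.all fun k => Dfn.all fun l => Dfn.all fun s =>
      Dfn.all fun t => Dfn.cond _ fun _ => Dfn.cond _ fun _ => Dfn.cond _ fun _ =>
      Dfn.cond _ fun _ => Dfn.eq (tmul (tvar (e (i, j, s))) (tvar (e (k, l, t))))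
        (tmul (tvar (e (k, l, t))) (tvar (e (i, j, s))))
  have h2 : Dfn N fun _ _ x => ∀ i j l k s t, i ≠ k → j ≠ i → j ≠ k → l ≠ i → l ≠ k →
      ⁅x (e (i, j, s)), x (e (j, k, t))⁆ = ⁅x (e (i, l, s)), x (e (l, k, t))⁆ :=
    Dfn.all fun i => Dfn.all fun j => Dfn.all fun l => Dfn.all fun k => Dfn.all fun s =>
      Dfn.all fun t => Dfn.cond _ fun _ => Dfn.cond _ fun _ => Dfn.cond _ fun _ =>
      Dfn.cond _ fun _ => Dfn.cond _ fun _ =>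
        Dfn.eq (tcomm (tvar (e (i, j, s))) (tvar (e (j, k, t))))
          (tcomm (tvar (e (i, l, s))) (tvar (e (l, k, t))))
  have h3 : Dfn N fun _ _ x => ∀ (k k' : K) (a b : Γ) (i j : Fin 5), k ≠ k' → i ≠ j →
      XW (fun i j s => x (e (i, j, s))) i j [Sum.inr (k, a), Sum.inr (k', b)] =
        XW (fun i j s => x (e (i, j, s))) i j [Sum.inr (k', b), Sum.inr (k, a)] :=
    Dfn.all fun k => Dfn.all fun k' => Dfn.all fun a => Dfn.all fun b => Dfn.all fun i =>
      Dfn.all fun j => Dfn.cond _ fun _ => Dfn.cond _ fun _ => hW _ _ _ _ _ _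
  have h4 : Dfn N fun _ _ x => ∀ (q : Q) (a : Γ) (i j : Fin 5), i ≠ j →
      ∀ u q', M.δ q a = some (u, q') →
      XW (fun i j s => x (e (i, j, s))) i j [Sum.inl q, Sum.inr (M.rd q, a)] =
        XW (fun i j s => x (e (i, j, s))) i j (Sum.inl q' :: u.map Sum.inr) := by
    refine Dfn.all fun q => Dfn.all fun a => Dfn.all fun i => Dfn.all fun j =>
      Dfn.cond _ fun _ => ?_
    cases hδ : M.δ q a with
    | none => exact Dfn.true.congr fun G _ x => by simp
    | some r =>
      refine (hW i j [Sum.inl q, Sum.inr (M.rd q, a)] i j (Sum.inl r.2 :: r.1.map Sum.inr)).congr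
        fun G _ x => ?_
      constructor
      · rintro h u q' ⟨⟩
        exact h
      · intro h
        exact h _ _ rfl
  have h5 : Dfn N fun _ _ x => ∀ (i j : Fin 5), i ≠ j →
      XW (fun i j s => x (e (i, j, s))) i j [Sum.inl qa, Sum.inr (M.rd qa, xa)] =
        XW (fun i j s => x (e (i, j, s))) 0 0 [] :=
    Dfn.all fun i => Dfn.all fun j => Dfn.cond _ fun _ => hW _ _ _ _ _ _
  refine (h1.and (h2.and (h3.and (h4.and h5)))).congr fun G _ x => ?_
  constructor
  · rintro ⟨h1, h2, h3, h4, h5⟩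
    refine ⟨⟨h1, h2⟩, ?_, h5⟩
    intro u v huv i j hij
    cases huv with
    | swap k k' a b hk => exact h3 k k' a b i j hk hij
    | step q a u q' h => exact h4 q a i j hij u q' h
  · rintro ⟨⟨h1, h2⟩, h3, h4⟩
    exact ⟨h1, h2, fun k k' a b i j hk hij => h3 _ _ (MRel.swap k k' a b hk) i j hij,
      fun q a i j hij u q' h => h3 _ _ (MRel.step q a u q' h) i j hij, h4⟩

/-- The term for the starting word. -/
def tT {A : Type} (e : Fin 5 × Fin 5 × A → Fin N) (a : A) (tail : List A) : ℕ → Tm N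
  | 0 => tXW e 1 2 tail
  | n + 1 => tcomm (tvar (e (1, 3, a))) (tcomm (tvar (e (3, 1, a))) (tT e a tail n))

theorem tval_tT {A : Type} (e : Fin 5 × Fin 5 × A → Fin N) (a : A) (tail : List A)
    (htail : tail ≠ []) (hx : St fun i j s => x (e (i, j, s))) (n : ℕ) :
    tval (tT e a tail n) x =
      XW (fun i j s => x (e (i, j, s))) 1 2 (List.replicate (2 * n) a ++ tail) := by
  induction n with
  | zero => rw [tT, tval_tXW]; rfl
  | succ n ih =>
    rw [tT, tval_comm, tval_comm, ih, tval_var, tval_var]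
    have h1 := XW_cons hx a (List.replicate (2 * n) a ++ tail) (by simp [htail]) 3 1 2
      (by decide) (by decide) (by decide)
    have h2 := XW_cons hx a (a :: (List.replicate (2 * n) a ++ tail)) (by simp) 1 3 2
      (by decide) (by decide) (by decide)
    rw [h1, h2]
    rfl

/-- The final term. -/
def tW {A : Type} (e : Fin 5 × Fin 5 × A → Fin N) (q a : A) (tail : List A) (n : ℕ) : Tm N :=
  tcomm (tvar (e (3, 1, q))) (tT e a tail n)

theorem tval_tW {A : Type} (e : Fin 5 × Fin 5 × A → Fin N) (q a : A) (tail : List A)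
    (htail : tail ≠ []) (hx : St fun i j s => x (e (i, j, s))) (n : ℕ) :
    tval (tW e q a tail n) x =
      XW (fun i j s => x (e (i, j, s))) 3 2 (q :: (List.replicate (2 * n) a ++ tail)) := by
  rw [tW, tval_comm, tval_tT x e a tail htail hx, tval_var]
  exact XW_cons hx q (List.replicate (2 * n) a ++ tail) (by simp [htail]) 3 1 2
      (by decide) (by decide) (by decide)

/-- The sentences. -/
def phi (R : grpLang.BoundedFormula Empty N) (t : Tm N) : grpLang.Sentence :=
  (R.imp (t.bdEqual tone)).alls

theorem phi_universal (R : grpLang.BoundedFormula Empty N) (hR : R.IsQF) (t : Tm N) :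
    IsUniversalSentence (phi R t) :=
  ⟨N, _, hR.imp (BoundedFormula.IsAtomic.equal _ _).isQF, rfl⟩

theorem phi_realize (R : grpLang.BoundedFormula Empty N) (t : Tm N) (G : Type) [Group G] :
    G ⊨ phi R t ↔
      ∀ x : Fin N → G, R.Realize (default : Empty → G) x → tval t x = 1 := by
  unfold phi Sentence.Realize
  rw [BoundedFormula.realize_alls]
  refine forall_congr' fun x => ?_
  rw [BoundedFormula.realize_imp, BoundedFormula.realize_bdEqual]
  rfl

end formulas

end Stein

namespace Stein

section coding
open FirstOrder.Language

theorem encode_list_map {α : Type*} [Encodable α] (l : List α) :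
    Encodable.encode l = Encodable.encode (l.map Encodable.encode) := by
  induction l with
  | nil => rfl
  | cons a l ih => rw [List.map_cons, Encodable.encode_list_cons, Encodable.encode_list_cons, ih]; rfl

variable {N : ℕ}

/-- The code of a term as a list of numbers. -/
def cT (t : Tm N) : List ℕ := t.listEncode.map Encodable.encode

theorem encode_tm (t : Tm N) : Encodable.encode t = Encodable.encode (cT t) :=
  encode_list_map t.listEncode

theorem cT_inv : ∃ i : ℕ, ∀ t : Tm N, cT (tinv t) = i :: cT t := by
  refine ⟨Encodable.encode (Sum.inr ⟨1, (show grpLang.Functions 1 from ())⟩ :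
    (Empty ⊕ Fin N) ⊕ (Σ i, grpLang.Functions i)), fun t => ?_⟩
  unfold cT tinv
  rw [Term.listEncode]
  simp only [List.map_cons, List.finRange_succ, List.finRange_zero, List.flatMap_cons, List.map_nil,
    List.flatMap_nil, List.append_nil]
  rfl

theorem cT_mul : ∃ m : ℕ, ∀ s t : Tm N, cT (tmul s t) = m :: (cT s ++ cT t) := by
  refine ⟨Encodable.encode (Sum.inr ⟨2, (show grpLang.Functions 2 from ())⟩ :
    (Empty ⊕ Fin N) ⊕ (Σ i, grpLang.Functions i)), fun s t => ?_⟩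
  unfold cT tmul
  rw [Term.listEncode]
  simp only [List.map_cons, List.finRange_succ, List.finRange_zero, List.flatMap_cons, List.map_nil,
    List.flatMap_nil, List.append_nil, List.map_append]
  rfl

theorem cT_comm : ∃ m i : ℕ, ∀ s t : Tm N, cT (tcomm s t) =
    m :: (m :: (m :: (cT s ++ cT t) ++ i :: cT s) ++ i :: cT t) := by
  obtain ⟨i, hi⟩ := cT_inv (N := N)
  obtain ⟨m, hm⟩ := cT_mul (N := N)
  exact ⟨m, i, fun s t => by simp only [tcomm, hi, hm]⟩

theorem primrec_cT_comm (s : Tm N) (f : ℕ → Tm N) (hf : Primrec fun n => cT (f n)) :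
    Primrec fun n => cT (tcomm s (f n)) := by
  obtain ⟨m, i, h⟩ := cT_comm (N := N)
  simp only [h]
  have hc : ∀ {f : ℕ → List ℕ} (c : ℕ), Primrec f → Primrec fun n => c :: f n :=
    fun c hf => Primrec.list_cons.comp (Primrec.const c) hf
  have ha : ∀ {f g : ℕ → List ℕ}, Primrec f → Primrec g → Primrec fun n => f n ++ g n :=
    fun hf hg => Primrec.list_append.comp hf hg
  exact hc m (ha (hc m (ha (hc m (ha (Primrec.const _) hf)) (hc i (Primrec.const _)))) (hc i hf))

theorem primrec_tT {A : Type} (e : Fin 5 × Fin 5 × A → Fin N) (a : A) (tail : List A) :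
    Primrec fun n => cT (tT e a tail n) := by
  obtain ⟨m, i, h⟩ := cT_comm (N := N)
  have hc : ∀ {f : ℕ × List ℕ → List ℕ} (c : ℕ), Primrec f → Primrec fun n => c :: f n :=
    fun c hf => Primrec.list_cons.comp (Primrec.const c) hf
  have ha : ∀ {f g : ℕ × List ℕ → List ℕ}, Primrec f → Primrec g → Primrec fun n => f n ++ g n :=
    fun hf hg => Primrec.list_append.comp hf hg
  have hcm : ∀ (s : List ℕ) {f : ℕ × List ℕ → List ℕ}, Primrec f → Primrec fun x =>
      m :: (m :: (m :: (s ++ f x) ++ i :: s) ++ i :: f x) := fun s f hf =>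
    hc m (ha (hc m (ha (hc m (ha (Primrec.const _) hf)) (hc i (Primrec.const _)))) (hc i hf))
  have h2 := hcm (cT (tvar (e (1, 3, a)))) (hcm (cT (tvar (e (3, 1, a)))) Primrec.snd)
  have h3 : Primrec₂ fun (_ : ℕ) (l : List ℕ) =>
      (fun t => m :: (m :: (m :: (cT (tvar (e (1, 3, a))) ++ t) ++ i :: cT (tvar (e (1, 3, a)))) ++
        i :: t))
      (m :: (m :: (m :: (cT (tvar (e (3, 1, a))) ++ l) ++ i :: cT (tvar (e (3, 1, a)))) ++
        i :: l)) := h2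
  refine (Primrec.nat_rec₁ (cT (tXW e 1 2 tail)) h3).of_eq fun n => ?_
  induction n with
  | zero => rfl
  | succ n ih =>
    simp only [tT, h, ← ih]

theorem alls_code {n : ℕ} (ψ : grpLang.BoundedFormula Empty n) :
    (BoundedFormula.listEncode ψ.alls) =
      List.replicate n (Sum.inr (Sum.inr 1)) ++ BoundedFormula.listEncode ψ := by
  induction n with
  | zero => rfl
  | succ n ih =>
    rw [BoundedFormula.alls, ih, BoundedFormula.listEncode, List.replicate_succ']
    simp

theorem encode_sent (φ : grpLang.Sentence) :
    Encodable.encode φ = Encodable.encode (BoundedFormula.listEncode φ) := rfl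

theorem primrec_phi (R : grpLang.BoundedFormula Empty N) (f : ℕ → Tm N)
    (hf : Primrec fun n => cT (f n)) :
    Primrec fun n => Encodable.encode (phi R (f n)) := by
  have key : ∃ l : List ℕ, ∃ b : ℕ, ∀ n, Encodable.encode (phi R (f n)) =
      Encodable.encode (l ++ [2 * Nat.pair N (Encodable.encode (cT (f n))), b]) := by
    refine ⟨(List.replicate N (Sum.inr (Sum.inr 1)) ++
        (Sum.inr (Sum.inr 0) :: BoundedFormula.listEncode R)).map Encodable.encode,
      Encodable.encode (Sum.inl ⟨N, tone⟩ : (Σ k, grpLang.Term (Empty ⊕ Fin k)) ⊕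
        ((Σ n, grpLang.Relations n) ⊕ ℕ)), fun n => ?_⟩
    rw [encode_sent, phi, alls_code, encode_list_map, BoundedFormula.listEncode, Term.bdEqual,
      BoundedFormula.listEncode, ← List.append_assoc, List.map_append, List.map_cons, List.map_cons,
      List.map_nil, ← encode_tm]
    rfl
  obtain ⟨l, b, h⟩ := key
  simp only [h]
  refine Primrec.encode.comp (Primrec.list_append.comp (Primrec.const l)
    (Primrec.list_cons.comp ?_ (Primrec.const [b])))
  exact Primrec.nat_mul.comp (Primrec.const 2)
    (Primrec₂.natPair.comp (Primrec.const N) (Primrec.encode.comp hf))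

theorem computable_phi {A : Type} (R : grpLang.BoundedFormula Empty N)
    (e : Fin 5 × Fin 5 × A → Fin N) (q a : A) (tail : List A) :
    Computable fun n => Encodable.encode (phi R (tW e q a tail n)) :=
  (primrec_phi R _ (primrec_cT_comm _ _ (primrec_tT e a tail))).to_comp

end coding

end Stein

namespace Stein

open Turing PartrecToTM2 StateTransition

theorem optK_finite : Finite (Option K') :=
  Finite.of_surjective (fun i : Fin 5 => match i with
    | 0 => none
    | 1 => some K'.main
    | 2 => some K'.rev
    | 3 => some K'.aux
    | 4 => some K'.stack) (by
    rintro (_ | _ | _ | _ | _)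
    exacts [⟨0, rfl⟩, ⟨1, rfl⟩, ⟨2, rfl⟩, ⟨3, rfl⟩, ⟨4, rfl⟩])

/-- The list of all stacks. -/
def allStacks : List (Option K') :=
  [some K'.main, some K'.rev, some K'.aux, some K'.stack, none]

theorem allStacks_nodup : allStacks.Nodup := by decide

theorem mem_allStacks (k : Option K') : k ∈ allStacks := by
  rcases k with _ | _ | _ | _ | _ <;> decide

/-- The part of the starting word which does not depend on the number fed to the machine. -/
def tailW (Q : Type) : List (Q ⊕ (Option K' × Option Γ')) :=
  [Sum.inr (some K'.main, some Γ'.bit1), Sum.inr (some K'.main, some Γ'.cons),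
    Sum.inr (some K'.main, none), Sum.inr (some K'.rev, none), Sum.inr (some K'.aux, none),
    Sum.inr (some K'.stack, none)]

theorem undecidable_aux (p : ℕ) (hp : p.Prime) (f : ℕ → Bool) (hf : Computable f)
    (hφ : ∀ φ : grpLang.Sentence, IsUniversalSentence φ →
        (f (Encodable.encode φ) = true ↔
          ∀ (G : Type) [Group G], IsPGroup p G → G ⊨ φ)) : False := by
  obtain ⟨c, hc⟩ := exists_diag_code
  obtain ⟨Q, _, M, q0, qa, hqa, hrd, hM⟩ := exists_machine c
  haveI := optK_finite
  haveI : Fintype (Option K') := Fintype.ofFinite _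
  obtain ⟨N, ⟨e⟩⟩ := Finite.exists_equiv_fin (Fin 5 × Fin 5 × (Q ⊕ (Option K' × Option Γ')))
  obtain ⟨R, hR, hR2⟩ := Dfn.sat M qa (some Γ'.bit1) e
  let a : Q ⊕ (Option K' × Option Γ') := Sum.inr (some K'.main, some Γ'.bit0)
  let t : ℕ → Tm N := tW e (Sum.inl q0) a (tailW Q)
  have ht : ∀ n (G : Type) [Group G] (x : Fin N → G),
      Sat M qa (some Γ'.bit1) (fun i j s => x (e (i, j, s))) →
      tval (t n) x = XW (fun i j s => x (e (i, j, s))) 3 2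
        (Sum.inl q0 :: SW allStacks (fun k => match k with
          | none => []
          | some K'.main => (trList [4 ^ n]).map some ++ [none]
          | some _ => [none])) := by
    intro n G _ x hx
    refine (tval_tW x e (Sum.inl q0) a (tailW Q) (by simp [tailW]) hx.st n).trans ?_
    congr 2
    simp [SW, allStacks, trList, trNat_pow4, tailW, a]
  refine no_sep (fun n => f (Encodable.encode (phi R (t n))))
    (hf.comp (computable_phi R e _ _ _)) ?_ ?_
  · intro n hn
    refine (hφ _ (phi_universal R hR _)).2 fun G _ _ => ?_
    refine (phi_realize R (t n) G).2 fun x hx => ?_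
    have hx := (hR2 G x).1 hx
    obtain ⟨T, hT, hr⟩ := hM _ _ (hc n 1 hn)
    rw [ht n G x hx]
    refine hx.accept allStacks allStacks_nodup mem_allStacks (l := [some Γ'.cons, none]) ?_ hr 3 2
      (by decide)
    rw [hrd, hT]
    rfl
  · intro n hn
    obtain ⟨T, hT, hr⟩ := hM _ _ (hc n 0 hn)
    have hT2 : T (some K'.main) = [some Γ'.cons, none] := by rw [hT]; rfl
    have hstep : M.step (qa, T) = none := by
      simp [SM.step, hrd, hT2, hqa]
    obtain ⟨G, _, X, hG, hs, hX⟩ := reject_model hp M qa (some Γ'.bit1) (hqa _) allStacks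
      allStacks_nodup mem_allStacks hr hstep (by
        rintro ⟨_, l, hl⟩
        rw [hrd] at hl
        simp [hT2] at hl)
    rw [Bool.eq_false_iff]
    intro hcon
    have h1 := (hφ _ (phi_universal R hR _)).1 hcon G hG
    have h2 := (phi_realize R (t n) G).1 h1
      (fun m => X (e.symm m).1 (e.symm m).2.1 (e.symm m).2.2)
    have hs' : Sat M qa (some Γ'.bit1) (fun i j s =>
        (fun m => X (e.symm m).1 (e.symm m).2.1 (e.symm m).2.2) (e (i, j, s))) := by
      simpa using hs
    have h3 := h2 ((hR2 G _).2 hs')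
    rw [ht n G _ hs'] at h3
    refine hX 3 2 (by decide) ?_
    simpa using h3

end Stein

/-- For every odd prime `p`, the universal theory of the class of `p`-groups is
undecidable. -/
theorem univTheory_pGroups_undecidable (p : ℕ) (hp : p.Prime) (hodd : Odd p) :
    ¬ ∃ f : ℕ → Bool, Computable f ∧
      ∀ φ : grpLang.Sentence, IsUniversalSentence φ →
        (f (Encodable.encode φ) = true ↔
          ∀ (G : Type) [Group G], IsPGroup p G → G ⊨ φ) := by
  rintro ⟨f, hf, hφ⟩
  exact Stein.undecidable_aux p hp f hf hφ
end

section
/- Let T be any set of L_grp-sentences such that Th∀(T) ⊆ T ⊆ Th∀(F), where Th∀(T) is the universal theory of the class of torsion groups and Th∀(F) is the universal theory of the class of finite groups. Then T is undecidable: there is no computable function deciding membership in T. -/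
open FirstOrder

/-- The universal theory of a class of groups: the set of universal sentences that hold
in every group of the class. -/
def UnivTheoryOf (C : (G : Type) → Group G → Prop) : Set grpLang.Sentence :=
  {φ | IsUniversalSentence φ ∧ ∀ (G : Type) [inst : Group G], C G inst → G ⊨ φ}

/-! ## Part 1: commutator calculus -/

/-- The commutator `a⁻¹ b⁻¹ a b`. -/
def cmt {G : Type*} [Group G] (a b : G) : G := a⁻¹ * b⁻¹ * a * b

theorem cmt_eq_one {G : Type*} [Group G] {a b : G} : cmt a b = 1 ↔ Commute a b := by
  unfold cmt Commute SemiconjBy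
  constructor
  · intro h
    have : b * a * (a⁻¹ * b⁻¹ * a * b) = b * a := by rw [h, mul_one]
    rw [← this]; group
  · intro h
    rw [mul_assoc, h]; group

theorem commute_cmt {G : Type*} [Group G] {x a b : G} (h1 : Commute x a) (h2 : Commute x b) :
    Commute x (cmt a b) := by
  unfold cmt
  exact ((h1.inv_right.mul_right h2.inv_right).mul_right h1).mul_right h2

theorem cmt_cmt {G : Type*} [Group G] {v a b : G} (h : Commute v b) (hc : Commute a (cmt a b)) :
    cmt (cmt v a) b = a⁻¹ * cmt v (cmt a b) * a := by
  set c := cmt a b with hcdef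
  have hab : a * b = b * a * c := by rw [hcdef]; unfold cmt; group
  have hb : b⁻¹ * v⁻¹ * b = v⁻¹ := by
    have : v⁻¹ * b = b * v⁻¹ := (h.inv_left).eq
    rw [mul_assoc, this]; group
  have e1 : cmt (cmt v a) b = a⁻¹ * v⁻¹ * a * v * (b⁻¹ * v⁻¹ * b) * ((a * b)⁻¹ * v * (a * b)) := by
    unfold cmt; group
  have hv : b⁻¹ * v * b = v := by
    have : v * b = b * v := h.eq
    rw [mul_assoc, this]; group
  have e2 : (a * b)⁻¹ * v * (a * b) = (a * c)⁻¹ * v * (a * c) := by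
    calc (a * b)⁻¹ * v * (a * b) = c⁻¹ * a⁻¹ * (b⁻¹ * v * b) * a * c := by rw [hab]; group
      _ = _ := by rw [hv]; group
  rw [e1, hb, e2, hc.eq]
  have h3 : a⁻¹ * c⁻¹ = c⁻¹ * a⁻¹ := by
    rw [← mul_inv_rev, ← mul_inv_rev, hc.eq]
  unfold cmt
  have h4 : a⁻¹ * (v⁻¹ * c⁻¹ * v * c) * a = a⁻¹ * v⁻¹ * c⁻¹ * v * (c * a) := by group
  rw [h4]
  have h5 : a⁻¹ * v⁻¹ * a * v * v⁻¹ * ((c * a)⁻¹ * v * (c * a))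
      = a⁻¹ * v⁻¹ * a * (a⁻¹ * c⁻¹) * v * (c * a) := by group
  rw [h5]; group

/-- The Steinberg-type relations. -/
structure ERel {G L : Type*} [Group G] (e : Fin 4 → Fin 4 → L → G) (C : L → L → Prop) : Prop where
  r1 : ∀ i j k l s s', i ≠ j → k ≠ l → j ≠ k → i ≠ l → Commute (e i j s) (e k l s')
  r2 : ∀ i j j' l s s', i ≠ j → j ≠ l → i ≠ l → i ≠ j' → j' ≠ l →
    cmt (e i j s) (e j l s') = cmt (e i j' s) (e j' l s')
  r3 : ∀ i j l s s', C s s' → i ≠ j → j ≠ l → i ≠ l →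
    cmt (e i j s) (e j l s') = cmt (e i j s') (e j l s)

/-- Families which behave like row vectors. -/
structure GoodFam {G L : Type*} [Group G] (e : Fin 4 → Fin 4 → L → G) (v : Fin 4 → G) : Prop where
  g1 : ∀ j k l s, k ≠ j → k ≠ l → Commute (v j) (e k l s)
  g2 : ∀ j j' k s, j ≠ k → j' ≠ k → cmt (v j) (e j k s) = cmt (v j') (e j' k s)

def actF {G L : Type*} [Group G] (e : Fin 4 → Fin 4 → L → G) (v : Fin 4 → G) (s : L) : Fin 4 → G :=
  fun k => cmt (v (k + 1)) (e (k + 1) k s)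

theorem fin4_succ_ne (k : Fin 4) : k + 1 ≠ k := by revert k; decide

theorem fin4_other (a b c : Fin 4) : ∃ d, d ≠ a ∧ d ≠ b ∧ d ≠ c := by revert a b c; decide

section
variable {G L : Type*} [Group G] {e : Fin 4 → Fin 4 → L → G} {C : L → L → Prop}

theorem actF_eq {v : Fin 4 → G} (hv : GoodFam e v) (s : L) {j k : Fin 4} (h : j ≠ k) :
    actF e v s k = cmt (v j) (e j k s) := hv.g2 _ _ _ _ (fin4_succ_ne k) h

theorem actF_g1 (he : ERel e C) {v : Fin 4 → G} (hv : GoodFam e v) (s : L) (j k l : Fin 4) (s' : L)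
    (h1 : k ≠ j) (h2 : k ≠ l) : Commute (actF e v s j) (e k l s') := by
  obtain ⟨i, hi1, hi2, hi3⟩ := fin4_other j k l
  rw [actF_eq hv s hi1]
  exact (commute_cmt (hv.g1 i k l s' hi2.symm h2).symm
    (he.r1 i j k l s s' hi1 h2 h1.symm hi3).symm).symm

/-- Key computation: two ways of expanding a double commutator agree. -/
theorem double_eq (he : ERel e C) {v : Fin 4 → G} (hv : GoodFam e v) (s s' t t' : L)
    {i j j' l : Fin 4} (hij : i ≠ j) (hij' : i ≠ j') (hil : i ≠ l) (hjj : j ≠ j') (hjl : j ≠ l)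
    (hjl' : j' ≠ l) (hc : cmt (e i j s) (e j l s') = cmt (e i j' t) (e j' l t')) :
    cmt (cmt (v i) (e i j s)) (e j l s') = cmt (cmt (v i) (e i j' t)) (e j' l t') := by
  set a := e i j s with ha
  set b := e j l s' with hb
  set a' := e i j' t with ha'
  set b' := e j' l t' with hb'
  set c := cmt a b with hcd
  have haa : Commute a a' := he.r1 _ _ _ _ _ _ hij hij' hij.symm hij'
  have hac : Commute a c := by
    rw [hc]
    exact commute_cmt haa (he.r1 _ _ _ _ _ _ hij hjl' hjj hil)
  have hac' : Commute a' c := by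
    rw [hcd]
    exact commute_cmt haa.symm (he.r1 _ _ _ _ _ _ hij' hjl hjj.symm hil)
  have w1 : cmt (cmt (v i) a) b = a⁻¹ * cmt (v i) c * a :=
    cmt_cmt (hv.g1 _ _ _ _ hij.symm hjl) hac
  have w2 : cmt (cmt (v i) a') b' = a'⁻¹ * cmt (v i) c * a' := by
    rw [hc]
    exact cmt_cmt (hv.g1 _ _ _ _ hij'.symm hjl') (hc ▸ hac')
  have c1 : Commute a' (cmt (cmt (v i) a) b) := by
    refine commute_cmt ?_ (he.r1 _ _ _ _ _ _ hij' hjl hjj.symm hil)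
    rw [← actF_eq hv s hij]
    exact (actF_g1 he hv s j i j' t hij hij').symm
  have c2 : Commute a (cmt (cmt (v i) a') b') := by
    refine commute_cmt ?_ (he.r1 _ _ _ _ _ _ hij hjl' hjj hil)
    rw [← actF_eq hv t hij']
    exact (actF_g1 he hv t j' i j s hij' hij).symm
  have k1 : cmt (cmt (v i) a) b = a'⁻¹ * cmt (cmt (v i) a) b * a' := by
    rw [mul_assoc, ← c1.eq]; group
  have k2 : cmt (cmt (v i) a') b' = a⁻¹ * cmt (cmt (v i) a') b' * a := by
    rw [mul_assoc, ← c2.eq]; group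
  rw [k1, k2, w1, w2]
  have : a * a' = a' * a := haa.eq
  calc a'⁻¹ * (a⁻¹ * cmt (v i) c * a) * a' = (a * a')⁻¹ * cmt (v i) c * (a * a') := by group
    _ = (a' * a)⁻¹ * cmt (v i) c * (a' * a) := by rw [this]
    _ = _ := by group

theorem actF_good (he : ERel e C) {v : Fin 4 → G} (hv : GoodFam e v) (s : L) :
    GoodFam e (actF e v s) where
  g1 := actF_g1 he hv s
  g2 := by
    intro j j' k s' hj hj'
    by_cases hjj : j = j'
    · subst hjj; rfl
    obtain ⟨i, hi1, hi2, hi3⟩ := fin4_other j j' k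
    rw [actF_eq hv s hi1, actF_eq hv s hi2]
    exact double_eq he hv s s' s s' hi1 hi2 hi3 hjj hj hj' (he.r2 _ _ _ _ _ _ hi1 hj hi3 hi2 hj')

theorem actF_comm (he : ERel e C) {v : Fin 4 → G} (hv : GoodFam e v) {s s' : L} (h : C s s') :
    actF e (actF e v s) s' = actF e (actF e v s') s := by
  funext l
  obtain ⟨j, hj, -, -⟩ := fin4_other l l l
  obtain ⟨j', hj', hjj, -⟩ := fin4_other l j j
  obtain ⟨i, hil, hij, hij'⟩ := fin4_other l j j'
  rw [actF_eq (actF_good he hv s) s' hj, actF_eq (actF_good he hv s') s hj',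
    actF_eq hv s hij, actF_eq hv s' hij']
  refine double_eq he hv s s' s' s hij hij' hil hjj.symm hj hj' ?_
  rw [he.r3 _ _ _ _ _ h hij hj hil]
  exact he.r2 _ _ _ _ _ _ hij hj hil hij' hj'

end


/-- Elementary matrices as units. -/
noncomputable def tvec {R : Type} [Ring R] (i j : Option (Fin 4)) (r : R) :
    (Matrix (Option (Fin 4)) (Option (Fin 4)) R)ˣ :=
  if h : i = j then 1 else
  { val := 1 + Matrix.single i j r
    inv := 1 - Matrix.single i j r
    val_inv := by
      have : Matrix.single i j r * Matrix.single i j r = 0 :=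
        Matrix.single_mul_single_of_ne _ _ _ _ (Ne.symm h) _
      rw [mul_sub, add_mul, add_mul, this]; simp
    inv_val := by
      have : Matrix.single i j r * Matrix.single i j r = 0 :=
        Matrix.single_mul_single_of_ne _ _ _ _ (Ne.symm h) _
      rw [mul_add, sub_mul, sub_mul, this]; simp }

section
variable {R : Type} [Ring R]

theorem tvec_val {i j : Option (Fin 4)} (h : i ≠ j) (r : R) :
    ((tvec i j r : (Matrix (Option (Fin 4)) (Option (Fin 4)) R)ˣ) :
      Matrix (Option (Fin 4)) (Option (Fin 4)) R) = 1 + Matrix.single i j r := by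
  simp [tvec, h]

theorem tvec_commute {i j k l : Option (Fin 4)} (h1 : i ≠ j) (h2 : k ≠ l) (h3 : j ≠ k) (h4 : i ≠ l)
    (r s : R) : Commute (tvec i j r) (tvec k l s) := by
  unfold Commute SemiconjBy
  ext1
  rw [Units.val_mul, Units.val_mul, tvec_val h1, tvec_val h2]
  have e1 : Matrix.single i j r * Matrix.single k l s = 0 :=
    Matrix.single_mul_single_of_ne _ _ _ _ h3 _
  have e2 : Matrix.single k l s * Matrix.single i j r = 0 :=
    Matrix.single_mul_single_of_ne _ _ _ _ h4.symm _
  simp only [mul_add, add_mul, e1, e2, mul_one, one_mul]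
  abel

theorem tvec_cmt {i j k : Option (Fin 4)} (h1 : i ≠ j) (h2 : j ≠ k) (h3 : i ≠ k) (r s : R) :
    cmt (tvec i j r) (tvec j k s) = tvec i k (r * s) := by
  have key : tvec i j r * tvec j k s = tvec j k s * tvec i j r * tvec i k (r * s) := by
    ext1
    simp only [Units.val_mul, tvec_val h1, tvec_val h2, tvec_val h3]
    have e1 : Matrix.single i j r * Matrix.single j k s = Matrix.single i k (r * s) :=
      Matrix.single_mul_single_same _ _ _ _ _
    have e2 : Matrix.single j k s * Matrix.single i j r = 0 :=
      Matrix.single_mul_single_of_ne _ _ _ _ h3.symm _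
    have e3 : Matrix.single i j r * Matrix.single i k (r * s) = 0 :=
      Matrix.single_mul_single_of_ne _ _ _ _ h1.symm _
    have e4 : Matrix.single j k s * Matrix.single i k (r * s) = 0 :=
      Matrix.single_mul_single_of_ne _ _ _ _ h3.symm _
    simp only [mul_add, add_mul, e1, e2, e3, e4, mul_one, one_mul, zero_mul, add_zero]
    abel
  unfold cmt
  rw [mul_assoc, key]
  group

theorem tvec_ne_one {i j : Option (Fin 4)} (h : i ≠ j) {r : R} (hr : r ≠ 0) : tvec i j r ≠ 1 := by
  intro h1
  have := congrArg (fun u : (Matrix (Option (Fin 4)) (Option (Fin 4)) R)ˣ =>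
    (u : Matrix (Option (Fin 4)) (Option (Fin 4)) R) i j) h1
  simp [tvec_val h, Matrix.one_apply_ne h] at this
  exact hr this

theorem tvec_zero (i j : Option (Fin 4)) : tvec i j (0 : R) = 1 := by
  by_cases h : i = j
  · simp [tvec, h]
  · ext1; simp [tvec_val h]

/-- The letters. -/
noncomputable def modE {L : Type} (m : L → R) (i j : Fin 4) (s : L) :
    (Matrix (Option (Fin 4)) (Option (Fin 4)) R)ˣ := tvec (some i) (some j) (m s)

/-- The row vectors. -/
noncomputable def modV (r : R) (j : Fin 4) :
    (Matrix (Option (Fin 4)) (Option (Fin 4)) R)ˣ := tvec none (some j) r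

theorem modE_rel {L : Type} (m : L → R) (C : L → L → Prop)
    (hC : ∀ s s', C s s' → m s * m s' = m s' * m s) : ERel (modE m) C where
  r1 := by
    intro i j k l s s' h1 h2 h3 h4
    exact tvec_commute (by simpa) (by simpa) (by simpa) (by simpa) _ _
  r2 := by
    intro i j j' l s s' h1 h2 h3 h4 h5
    unfold modE
    rw [tvec_cmt (by simpa) (by simpa) (by simpa), tvec_cmt (by simpa) (by simpa) (by simpa)]
  r3 := by
    intro i j l s s' hc h1 h2 h3
    unfold modE
    rw [tvec_cmt (by simpa) (by simpa) (by simpa), tvec_cmt (by simpa) (by simpa) (by simpa),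
      hC _ _ hc]

theorem modV_good {L : Type} (m : L → R) (r : R) : GoodFam (modE m) (modV r) where
  g1 := by
    intro j k l s h1 h2
    exact tvec_commute (by simp) (by simpa) (by simpa using h1.symm) (by simp) _ _
  g2 := by
    intro j j' k s h1 h2
    unfold modE modV
    rw [tvec_cmt (by simp) (by simpa) (by simp), tvec_cmt (by simp) (by simpa) (by simp)]

theorem modV_act {L : Type} (m : L → R) (r : R) (s : L) :
    actF (modE m) (modV r) s = modV (r * m s) := by
  funext k
  unfold actF modE modV
  rw [tvec_cmt (by simp) (by simp) (by simp)]

theorem modV_foldl {L : Type} (m : L → R) (r : R) (w : List L) :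
    w.foldl (actF (modE m)) (modV r) = modV (r * (w.map m).prod) := by
  induction w generalizing r with
  | nil => simp
  | cons s w ih => rw [List.foldl_cons, modV_act, ih, List.map_cons, List.prod_cons, mul_assoc]

end

/-! ## Part 3: stack machines -/

/-- A machine with several stacks. In state `q` it pops the top of stack `key q` and, depending on
the symbol (`none` for an empty stack), enters a new state and pushes a list. -/
structure StkMach (Q K A : Type) where
  key : Q → K
  nxt : Q → Option A → Option (Q × List A)
  rej : Q → Option A → Prop
  rej_halt : ∀ q x, rej q x → nxt q x = none

namespace StkMach

/-- Letters: the clock `none`, stack symbols and end markers. -/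
abbrev Ltr (K A : Type) : Type := Option (K × Option A)

/-- Letters which should commute. -/
def Lcomm {K A : Type} : Ltr K A → Ltr K A → Prop
  | some (k, _), some (k', _) => k ≠ k'
  | _, _ => True

variable {Q K A : Type} [DecidableEq K]

/-- One step. -/
def step (M : StkMach Q K A) (c : Q × (K → List A)) : Option (Q × (K → List A)) :=
  (M.nxt c.1 (c.2 (M.key c.1)).head?).map fun p =>
    (p.1, Function.update c.2 (M.key c.1) (p.2 ++ (c.2 (M.key c.1)).tail))

/-- The stack symbols as letters. -/
def wlet (k : K) (w : List A) : List (Ltr K A) := w.map fun a => some (k, some a)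

/-- The end marker. -/
def emark (k : K) : Option A → List (Ltr K A)
  | none => [some (k, none)]
  | some _ => []

/-- The replacement word. -/
def repl (k : K) (x : Option A) (w : List A) : List (Ltr K A) := wlet k w ++ emark k x ++ [none]

/-- The word describing all the stacks. -/
def full (ks : List K) (S : K → List A) : List (Ltr K A) :=
  ks.flatMap fun k => wlet k (S k) ++ emark k none

section sim
variable {V : Type*} (act : V → Ltr K A → V)

theorem foldl_comm_one (hcomm : ∀ v s s', Lcomm s s' → act (act v s) s' = act (act v s') s)
    (s : Ltr K A) (w : List (Ltr K A)) (h : ∀ s' ∈ w, Lcomm s s') (v : V) :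
    w.foldl act (act v s) = act (w.foldl act v) s := by
  induction w generalizing v with
  | nil => rfl
  | cons a w ih =>
    rw [List.foldl_cons, List.foldl_cons, hcomm _ _ _ (h a (by simp)),
      ih (fun s' hs' => h s' (by simp [hs']))]

theorem foldl_comm_two (hcomm : ∀ v s s', Lcomm s s' → act (act v s) s' = act (act v s') s)
    (u w : List (Ltr K A)) (h : ∀ s ∈ u, ∀ s' ∈ w, Lcomm s s') (v : V) :
    w.foldl act (u.foldl act v) = u.foldl act (w.foldl act v) := by
  induction u generalizing v with
  | nil => rfl
  | cons a u ih =>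
    rw [List.foldl_cons, List.foldl_cons, ih (fun s hs => h s (by simp [hs])),
      foldl_comm_one act hcomm a w (h a (by simp))]

theorem mem_blk {k : K} {l : List A} {s : Ltr K A} (h : s ∈ wlet k l ++ emark k none) :
    ∃ x, s = some (k, x) := by
  simp only [wlet, emark, List.mem_append, List.mem_map, List.mem_singleton] at h
  rcases h with ⟨a, _, rfl⟩ | rfl <;> exact ⟨_, rfl⟩

theorem full_perm (hcomm : ∀ v s s', Lcomm s s' → act (act v s) s' = act (act v s') s)
    (S : K → List A) {ks ks' : List K} (h : ks.Perm ks') (v : V) :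
    (full ks S).foldl act v = (full ks' S).foldl act v := by
  unfold full
  rw [List.foldl_flatMap, List.foldl_flatMap]
  refine List.Perm.foldl_eq' h ?_ v
  intro k _ k' _ v
  by_cases hk : k = k'
  · subst hk; rfl
  refine foldl_comm_two act hcomm _ _ ?_ v
  intro s hs s' hs'
  obtain ⟨x, rfl⟩ := mem_blk hs
  obtain ⟨x', rfl⟩ := mem_blk hs'
  first | exact hk | exact Ne.symm hk

theorem sim_step (M : StkMach Q K A)
    (hcomm : ∀ v s s', Lcomm s s' → act (act v s) s' = act (act v s') s) (qv : Q → V)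
    (hrule : ∀ q x q' w, M.nxt q x = some (q', w) →
      act (qv q) (some (M.key q, x)) = (repl (M.key q) x w).foldl act (qv q'))
    {ks : List K} (hnd : ks.Nodup) (hks : ∀ k, k ∈ ks) {c c' : Q × (K → List A)}
    (h : c' ∈ M.step c) :
    (full ks c.2).foldl act (qv c.1) = act ((full ks c'.2).foldl act (qv c'.1)) none := by
  obtain ⟨q, S⟩ := c
  simp only [step, Option.mem_def, Option.map_eq_some_iff] at h
  obtain ⟨⟨q', w⟩, hn, rfl⟩ := h
  have hr := hrule _ _ _ _ hn
  set k := M.key q with hk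
  have hp := List.perm_cons_erase (hks k)
  have hne : k ∉ ks.erase k := by
    intro h; exact (List.Nodup.mem_erase_iff hnd).1 h |>.1 rfl
  rw [full_perm act hcomm _ hp, full_perm act hcomm _ hp]
  have hrest : full (ks.erase k) (Function.update S k (w ++ (S k).tail)) = full (ks.erase k) S := by
    unfold full
    refine List.flatMap_congr ?_
    intro k' hk'
    rw [Function.update_of_ne]
    rintro rfl; exact hne hk'
  have hcons : ∀ S' : K → List A, full (k :: ks.erase k) S' =
      wlet k (S' k) ++ emark k none ++ full (ks.erase k) S' := fun S' => by
    simp [full, List.flatMap_cons]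
  rw [hcons, hcons, hrest]
  simp only [Function.update_self]
  have hcl : ∀ (u : List (Ltr K A)) (v : V), u.foldl act (act v none) = act (u.foldl act v) none := by
    intro u v
    exact foldl_comm_one act hcomm none u (fun _ _ => trivial) v
  rw [List.foldl_append, List.foldl_append (l' := full (ks.erase k) S), ← hcl]
  congr 1
  cases hS : S k with
  | nil =>
    rw [hS] at hr
    simp only [List.head?_nil] at hr
    simp only [wlet, emark, List.map_nil, List.nil_append, List.foldl_cons, List.foldl_nil, hr,
      repl, List.foldl_append, List.tail_nil, List.append_nil]
  | cons a l =>
    rw [hS] at hr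
    simp only [List.head?_cons] at hr
    simp only [wlet, emark, List.map_cons, List.foldl_cons, List.foldl_nil, hr,
      repl, List.foldl_append, List.tail_cons, List.append_nil, List.map_append]
    rw [hcl, hcomm _ none _ trivial]

theorem sim (M : StkMach Q K A)
    (hcomm : ∀ v s s', Lcomm s s' → act (act v s) s' = act (act v s') s) (qv : Q → V)
    (hrule : ∀ q x q' w, M.nxt q x = some (q', w) →
      act (qv q) (some (M.key q, x)) = (repl (M.key q) x w).foldl act (qv q'))
    (o : V) (ho : ∀ s, act o s = o)
    (hrej : ∀ q x, M.rej q x → act (qv q) (some (M.key q, x)) = o)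
    {ks : List K} (hnd : ks.Nodup) (hks : ∀ k, k ∈ ks) {c c' : Q × (K → List A)}
    (h : Relation.ReflTransGen (fun a b => b ∈ M.step a) c c')
    (hfin : M.rej c'.1 (c'.2 (M.key c'.1)).head?) :
    (full ks c.2).foldl act (qv c.1) = o := by
  have hoo : ∀ u : List (Ltr K A), u.foldl act o = o := by
    intro u
    induction u with
    | nil => rfl
    | cons a u ih => rw [List.foldl_cons, ho, ih]
  induction h using Relation.ReflTransGen.head_induction_on with
  | refl =>
    obtain ⟨q, S⟩ := c'
    simp only at hfin ⊢
    have hr := hrej _ _ hfin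
    set k := M.key q with hk
    have hp := List.perm_cons_erase (hks k)
    rw [full_perm act hcomm _ hp]
    have hcons : full (k :: ks.erase k) S =
        wlet k (S k) ++ emark k none ++ full (ks.erase k) S := by
      simp [full, List.flatMap_cons]
    rw [hcons]
    cases hS : S k with
    | nil =>
      rw [hS] at hr
      simp only [List.head?_nil] at hr
      simp only [wlet, emark, List.map_nil, List.nil_append, List.foldl_cons, hr,
        List.foldl_append, List.foldl_nil, hoo]
    | cons a l =>
      rw [hS] at hr
      simp only [List.head?_cons] at hr
      simp only [wlet, List.map_cons, List.foldl_cons, hr, List.foldl_append, hoo]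
  | head hstep _ ih =>
    rw [sim_step act M hcomm qv hrule hnd hks hstep, ih, ho]

end sim

end StkMach

/-! ## Part 4: the finite ring of an accepting computation -/

/-- Composition of partial functions. -/
def kcomp {X : Type} (f g : X → Option X) : X → Option X := fun y => (g y).bind f

/-- The matrix of a partial function restricted to a set. -/
noncomputable def pmat {X : Type} (B : Set X) (f : X → Option X) : Matrix B B (ZMod 2) :=
  open Classical in fun x y => if f y = some x.1 then 1 else 0

/-- Only points of `B` are sent to points of `B`. -/
def Refl {X : Type} (B : Set X) (f : X → Option X) : Prop := ∀ y z, f y = some z → z ∈ B → y ∈ B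

theorem pmat_mul {X : Type} (B : Set X) [Fintype B] {f : X → Option X} (hf : Refl B f)
    (g : X → Option X) : pmat B f * pmat B g = pmat B (kcomp f g) := by
  classical
  ext z y
  rw [Matrix.mul_apply]
  unfold pmat kcomp
  cases hg : g y with
  | none => simp
  | some x =>
    by_cases hx : x ∈ B
    · rw [Finset.sum_eq_single ⟨x, hx⟩]
      · simp
      · intro b _ hb
        have : ¬ (some x = some b.1) := by
          intro h; apply hb; ext; simpa using h.symm
        simp [this]
      · simp
    · rw [Finset.sum_eq_zero]
      · have : f x ≠ some z.1 := fun h => hx (hf _ _ h z.2)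
        simp [this]
      · intro b _
        have : ¬ (x = b.1) := by
          intro h; apply hx; rw [h]; exact b.2
        simp [this]

theorem pmat_some {X : Type} (B : Set X) [DecidableEq B] : pmat B (some : X → Option X) = 1 := by
  classical
  ext x y
  unfold pmat
  by_cases h : x = y
  · subst h; simp
  · have : ¬ (y.1 = x.1) := fun h' => h (Subtype.ext h'.symm)
    simp [h, this]

theorem kcomp_refl {X : Type} {B : Set X} {f g : X → Option X} (hf : Refl B f) (hg : Refl B g) :
    Refl B (kcomp f g) := by
  intro y z h hz
  simp only [kcomp, Option.bind_eq_some_iff] at h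
  obtain ⟨x, h1, h2⟩ := h
  exact hg _ _ h1 (hf _ _ h2 hz)

namespace StkMach

variable {Q K A : Type} [DecidableEq K]

/-- The meaning of letters as partial functions. -/
def pl [DecidableEq A] : Ltr K A → (K → List A) × ℕ → Option ((K → List A) × ℕ)
  | none, y => some (y.1, y.2 + 1)
  | some (k, some a), y => some (Function.update y.1 k (a :: y.1 k), y.2)
  | some (k, none), y => if y.1 k = [] then some y else none

/-- The meaning of words. -/
def wsem [DecidableEq A] : List (Ltr K A) → (K → List A) × ℕ → Option ((K → List A) × ℕ)
  | [] => some
  | x :: w => kcomp (pl x) (wsem w)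

variable [DecidableEq A]

theorem wsem_append (u w : List (Ltr K A)) : wsem (u ++ w) = kcomp (wsem u) (wsem w) := by
  induction u with
  | nil => funext y; simp [wsem, kcomp]
  | cons a u ih =>
    funext y
    simp only [List.cons_append, wsem, ih, kcomp, Option.bind_assoc]
    rfl

theorem wsem_wlet (k : K) (w : List A) (y : (K → List A) × ℕ) :
    wsem (wlet k w) y = some (Function.update y.1 k (w ++ y.1 k), y.2) := by
  induction w with
  | nil => simp [wlet, wsem]
  | cons a w ih =>
    have : wlet k (a :: w) = some (k, some a) :: wlet k w := rfl
    rw [this]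
    simp [wsem, kcomp, ih, pl]

/-- `n` steps. -/
def stepsN (M : StkMach Q K A) : ℕ → Q × (K → List A) → Option (Q × (K → List A))
  | 0, c => some c
  | n + 1, c => (M.step c).bind (M.stepsN n)

theorem exists_stepsN (M : StkMach Q K A) {c c' : Q × (K → List A)}
    (h : Relation.ReflTransGen (fun a b => b ∈ M.step a) c c') : ∃ n, M.stepsN n c = some c' := by
  induction h using Relation.ReflTransGen.head_induction_on with
  | refl => exact ⟨0, rfl⟩
  | head hs _ ih =>
    obtain ⟨n, hn⟩ := ih
    refine ⟨n + 1, ?_⟩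
    rw [Option.mem_def] at hs
    rw [stepsN, hs]
    exact hn

theorem stepsN_length (M : StkMach Q K A) (n : ℕ) {c c' : Q × (K → List A)}
    (h : M.stepsN n c = some c') (k : K) : (c.2 k).length ≤ (c'.2 k).length + n := by
  induction n generalizing c with
  | zero => simp [stepsN] at h; subst h; simp
  | succ n ih =>
    simp only [stepsN, Option.bind_eq_some_iff] at h
    obtain ⟨d, hd, h⟩ := h
    have := ih h
    simp only [step, Option.map_eq_some_iff] at hd
    obtain ⟨p, hp, rfl⟩ := hd
    simp only at this
    by_cases hk : k = M.key c.1
    · subst hk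
      simp at this
      omega
    · rw [Function.update_of_ne hk] at this
      omega

/-- Acceptance with a clock. -/
def Acc (M : StkMach Q K A) (T : ℕ) (fin : Q × (K → List A)) (q : Q) (y : (K → List A) × ℕ) : Prop :=
  ∃ n, y.2 + n = T ∧ M.stepsN n (q, y.1) = some fin

theorem acc_step (M : StkMach Q K A) {T : ℕ} {fin : Q × (K → List A)} (hfin : M.step fin = none)
    {q q' : Q} {S S' : K → List A} (h : M.step (q, S) = some (q', S')) (t : ℕ) :
    M.Acc T fin q (S, t) ↔ M.Acc T fin q' (S', t + 1) := by
  constructor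
  · rintro ⟨n, hn, h1⟩
    cases n with
    | zero =>
      simp [stepsN] at h1
      rw [h1, hfin] at h
      simp at h
    | succ n =>
      refine ⟨n, by simp only at hn ⊢; omega, ?_⟩
      simpa [stepsN, h] using h1
  · rintro ⟨n, hn, h1⟩
    refine ⟨n + 1, by simp only at hn ⊢; omega, ?_⟩
    simpa [stepsN, h] using h1

/-- The meaning of states. -/
noncomputable def pq (M : StkMach Q K A) (T : ℕ) (fin : Q × (K → List A)) (q : Q)
    (y : (K → List A) × ℕ) : Option ((K → List A) × ℕ) :=
  open Classical in if M.Acc T fin q y then some (fun _ => [], 0) else none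

theorem wsem_repl_some (k : K) (a : A) (w : List A) (S : K → List A) (t : ℕ) :
    wsem (repl k (some a) w) (S, t) = some (Function.update S k (w ++ S k), t + 1) := by
  simp [repl, wsem_append, emark, wsem, kcomp, pl, wsem_wlet]

theorem wsem_repl_none (k : K) (w : List A) (S : K → List A) (t : ℕ) :
    wsem (repl k none w) (S, t) =
      if S k = [] then some (Function.update S k (w ++ S k), t + 1) else none := by
  by_cases h : S k = [] <;> simp [repl, wsem_append, emark, wsem, kcomp, pl, wsem_wlet, h]

theorem pq_congr (M : StkMach Q K A) {T : ℕ} {fin : Q × (K → List A)} {q q' : Q}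
    {y y' : (K → List A) × ℕ} (h : M.Acc T fin q y ↔ M.Acc T fin q' y') :
    M.pq T fin q y = M.pq T fin q' y' := by
  unfold pq
  by_cases h1 : M.Acc T fin q y
  · rw [if_pos h1, if_pos (h.1 h1)]
  · rw [if_neg h1, if_neg (fun h2 => h1 (h.2 h2))]

theorem pq_rule (M : StkMach Q K A) {T : ℕ} {fin : Q × (K → List A)} (hfin : M.step fin = none)
    {q q' : Q} {x : Option A} {w : List A} (h : M.nxt q x = some (q', w)) :
    kcomp (M.pq T fin q) (pl (some (M.key q, x))) =
      kcomp (M.pq T fin q') (wsem (repl (M.key q) x w)) := by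
  funext ⟨S, t⟩
  cases x with
  | none =>
    simp only [kcomp, wsem_repl_none, pl]
    by_cases hS : S (M.key q) = []
    · have hst : M.step (q, S) =
          some (q', Function.update S (M.key q) (w ++ (S (M.key q)).tail)) := by
        simp only [step, hS, List.head?_nil, h, Option.map_some]
      have := M.acc_step (T := T) hfin hst t
      rw [if_pos hS, if_pos hS]
      rw [hS] at this ⊢
      exact M.pq_congr this
    · simp [hS]
  | some a =>
    simp only [kcomp, wsem_repl_some, pl, Option.bind_some]
    have hst : M.step (q, Function.update S (M.key q) (a :: S (M.key q))) =
        some (q', Function.update S (M.key q) (w ++ S (M.key q))) := by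
      simp [step, h]
    exact M.pq_congr (M.acc_step (T := T) hfin hst t)

theorem pq_rej (M : StkMach Q K A) {T : ℕ} {fin : Q × (K → List A)}
    (hnr : ¬ M.rej fin.1 (fin.2 (M.key fin.1)).head?)
    {q : Q} {x : Option A} (h : M.rej q x) :
    kcomp (M.pq T fin q) (pl (some (M.key q, x))) = fun _ => none := by
  have key : ∀ S t, (S (M.key q)).head? = x → M.pq T fin q (S, t) = none := by
    intro S t hS
    unfold pq
    rw [if_neg]
    rintro ⟨n, hn, h1⟩
    cases n with
    | zero =>
      simp [stepsN] at h1
      subst h1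
      simp only at hnr
      rw [hS] at hnr
      exact hnr h
    | succ n =>
      have : M.step (q, S) = none := by
        simp [step, hS, M.rej_halt q x h]
      simp [stepsN, this] at h1
  funext ⟨S, t⟩
  cases x with
  | none =>
    simp only [kcomp, pl]
    by_cases hS : S (M.key q) = []
    · simp only [hS, if_true, Option.bind_some]
      exact key _ _ (by simp [hS])
    · simp [hS]
  | some a =>
    simp only [kcomp, pl, Option.bind_some]
    exact key _ _ (by simp)

theorem pl_comm (s s' : Ltr K A) (h : Lcomm s s') : kcomp (pl s) (pl s') = kcomp (pl s') (pl s) := by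
  funext ⟨S, t⟩
  rcases s with _ | ⟨k, _ | a⟩ <;> rcases s' with _ | ⟨k', _ | a'⟩ <;>
    simp only [kcomp, pl, Option.bind_some]
  · split_ifs <;> simp [pl]
  · split_ifs <;> simp_all [pl]
  · by_cases h1 : S k = [] <;> by_cases h2 : S k' = [] <;> simp [h1, h2, pl]
  · have h : k ≠ k' := h
    by_cases h1 : S k = [] <;> simp [h1, h, pl]
  · have h : k ≠ k' := h
    by_cases h1 : S k' = [] <;> simp [h1, h.symm, pl]
  · have h : k ≠ k' := h
    simp only [Function.update_of_ne h, Function.update_of_ne h.symm]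
    rw [Function.update_comm h]

theorem wsem_full (ks : List K) (hnd : ks.Nodup) (S : K → List A) :
    wsem (full ks S) (fun _ => [], 0) = some (fun k => if k ∈ ks then S k else [], 0) := by
  induction ks with
  | nil => simp [full, wsem]
  | cons k ks ih =>
    rw [List.nodup_cons] at hnd
    have : full (k :: ks) S = wlet k (S k) ++ (emark k none ++ full ks S) := by
      simp [full, List.flatMap_cons]
    rw [this, wsem_append, wsem_append]
    simp only [kcomp, ih hnd.2, Option.bind_some, emark, wsem, pl, hnd.1, if_false, if_true,
      wsem_wlet]
    congr 2
    funext k'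
    by_cases hk : k' = k
    · subst hk; simp
    · simp [hk]

/-- The bounded configurations. -/
def bnd (K A : Type) (N : ℕ) : Set ((K → List A) × ℕ) := {y | (∀ k, (y.1 k).length ≤ N) ∧ y.2 ≤ N}

theorem bnd_finite [Finite K] [Finite A] (N : ℕ) : (bnd K A N).Finite := by
  have h1 : (Set.univ.pi fun _ : K => {l : List A | l.length ≤ N}).Finite :=
    Set.Finite.pi fun _ => List.finite_length_le A N
  refine (h1.prod (Set.finite_Iic N)).subset ?_
  rintro ⟨S, t⟩ ⟨ha, hb⟩
  exact ⟨fun k _ => ha k, hb⟩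

theorem pl_refl (N : ℕ) (s : Ltr K A) : Refl (bnd K A N) (pl s) := by
  rintro ⟨S, t⟩ z h hz
  rcases s with _ | ⟨k, _ | a⟩
  · simp only [pl, Option.some.injEq] at h
    subst h
    exact ⟨hz.1, by have := hz.2; simp only at this ⊢; omega⟩
  · simp only [pl] at h
    split_ifs at h
    simp only [Option.some.injEq] at h
    subst h
    exact hz
  · simp only [pl, Option.some.injEq] at h
    subst h
    refine ⟨fun k' => ?_, hz.2⟩
    have := hz.1 k'
    by_cases hk : k' = k
    · subst hk; simp at this; simp only; omega
    · simpa [hk] using this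

theorem wsem_refl (N : ℕ) (w : List (Ltr K A)) : Refl (bnd K A N) (wsem w) := by
  induction w with
  | nil =>
    intro y z h hz
    simp only [wsem, Option.some.injEq] at h
    subst h; exact hz
  | cons a w ih => exact kcomp_refl (pl_refl N a) ih

theorem pq_refl (M : StkMach Q K A) {T N : ℕ} {fin : Q × (K → List A)} (hT : T ≤ N)
    (hN : ∀ k, (fin.2 k).length + T ≤ N) (q : Q) : Refl (bnd K A N) (M.pq T fin q) := by
  rintro ⟨S, t⟩ z h hz
  unfold pq at h
  split_ifs at h with hacc
  obtain ⟨n, hn, h1⟩ := hacc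
  simp only at hn h1
  refine ⟨fun k => ?_, by simp only; omega⟩
  have := M.stepsN_length n h1 k
  have := hN k
  simp only at *
  omega

theorem wsem_pmat (B : Set ((K → List A) × ℕ)) [Fintype B] [DecidableEq B]
    (hB : ∀ s : Ltr K A, Refl B (pl s)) (w : List (Ltr K A)) :
    (w.map fun s => pmat B (pl s)).prod = pmat B (wsem w) := by
  induction w with
  | nil => simp [wsem, pmat_some]
  | cons a w ih => rw [List.map_cons, List.prod_cons, ih, pmat_mul B (hB a)]; rfl

/-- An accepting computation gives a finite ring. -/
theorem exists_ring [Finite K] [Finite A] (M : StkMach Q K A) {ks : List K} (hnd : ks.Nodup)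
    (hks : ∀ k, k ∈ ks) {c fin : Q × (K → List A)}
    (h : Relation.ReflTransGen (fun a b => b ∈ M.step a) c fin) (hfin : M.step fin = none)
    (hnr : ¬ M.rej fin.1 (fin.2 (M.key fin.1)).head?) :
    ∃ (R : Type) (_ : Ring R) (_ : Finite R) (m : Ltr K A → R) (mq : Q → R),
      (∀ s s', Lcomm s s' → m s * m s' = m s' * m s) ∧
      (∀ q x q' w, M.nxt q x = some (q', w) →
        mq q * m (some (M.key q, x)) = mq q' * ((repl (M.key q) x w).map m).prod) ∧
      (∀ q x, M.rej q x → mq q * m (some (M.key q, x)) = 0) ∧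
      mq c.1 * ((full ks c.2).map m).prod ≠ 0 := by
  classical
  obtain ⟨T, hT⟩ := M.exists_stepsN h
  have := Fintype.ofFinite K
  set N := (Finset.univ.sup fun k => (fin.2 k).length) + T with hN
  have hN1 : T ≤ N := by omega
  have hN2 : ∀ k, (fin.2 k).length + T ≤ N := by
    intro k
    have : (fin.2 k).length ≤ Finset.univ.sup fun k => (fin.2 k).length :=
      Finset.le_sup (f := fun k => (fin.2 k).length) (Finset.mem_univ k)
    omega
  set B := bnd K A N with hB
  have : Fintype B := (bnd_finite N).fintype
  have hpq := M.pq_refl hN1 hN2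
  have hpl := pl_refl (K := K) (A := A) N
  refine ⟨Matrix B B (ZMod 2), inferInstance, inferInstance, fun s => pmat B (pl s),
    fun q => pmat B (M.pq T fin q), ?_, ?_, ?_, ?_⟩
  · intro s s' hs
    simp only
    rw [pmat_mul B (hpl s), pmat_mul B (hpl s'), pl_comm s s' hs]
  · intro q x q' w hq
    simp only
    rw [wsem_pmat B hpl, pmat_mul B (hpq q), pmat_mul B (hpq q'), M.pq_rule hfin hq]
  · intro q x hq
    simp only
    rw [pmat_mul B (hpq q), M.pq_rej hnr hq]
    ext; simp [pmat]
  · simp only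
    rw [wsem_pmat B hpl, pmat_mul B (hpq _)]
    have hy : ((fun _ => [], 0) : (K → List A) × ℕ) ∈ B := ⟨fun _ => by simp, by simp⟩
    intro h0
    have h1 := congrFun (congrFun h0 ⟨_, hy⟩) ⟨_, hy⟩
    have hacc : M.Acc T fin c.1 (c.2, 0) := ⟨T, by simp, hT⟩
    simp only [pmat, kcomp, wsem_full ks hnd, hks, if_true, Option.bind_some, pq, hacc,
      Matrix.zero_apply] at h1
    exact one_ne_zero h1

end StkMach

/-! ## Part 5: from partial recursive functions to stack machines -/

namespace StkMach

/-- Restriction of a machine to a set of states. -/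
noncomputable def restrict {Q K A : Type} (M : StkMach Q K A) (P : Set Q) : StkMach P K A where
  key q := M.key q.1
  nxt q x := open Classical in (M.nxt q.1 x).bind fun p =>
    if h : p.1 ∈ P then some (⟨p.1, h⟩, p.2) else none
  rej q x := M.rej q.1 x
  rej_halt q x h := by rw [M.rej_halt _ _ h]; rfl

theorem restrict_step {Q K A : Type} [DecidableEq K] (M : StkMach Q K A) (P : Set Q)
    (hP : ∀ q x q' w, q ∈ P → M.nxt q x = some (q', w) → q' ∈ P) (q : P) (S : K → List A)
    {c : Q × (K → List A)} (h : c ∈ M.step (q.1, S)) :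
    ∃ hc : c.1 ∈ P, (⟨c.1, hc⟩, c.2) ∈ (M.restrict P).step (q, S) := by
  simp only [step, Option.mem_def, Option.map_eq_some_iff] at h
  obtain ⟨⟨q', w⟩, hn, rfl⟩ := h
  have hq := hP _ _ _ _ q.2 hn
  refine ⟨hq, ?_⟩
  simp [step, restrict, hn, hq]

theorem restrict_step_none {Q K A : Type} [DecidableEq K] (M : StkMach Q K A) (P : Set Q)
    (q : P) (S : K → List A) (h : M.step (q.1, S) = none) :
    (M.restrict P).step (q, S) = none := by
  simp only [step, Option.map_eq_none_iff] at h
  simp [step, restrict, h]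

theorem restrict_reach {Q K A : Type} [DecidableEq K] (M : StkMach Q K A) (P : Set Q)
    (hP : ∀ q x q' w, q ∈ P → M.nxt q x = some (q', w) → q' ∈ P) {c c' : Q × (K → List A)}
    (h : Relation.ReflTransGen (fun a b => b ∈ M.step a) c c') (hc : c.1 ∈ P) :
    ∃ hc' : c'.1 ∈ P, Relation.ReflTransGen (fun a b => b ∈ (M.restrict P).step a)
      (⟨c.1, hc⟩, c.2) (⟨c'.1, hc'⟩, c'.2) := by
  induction h with
  | refl => exact ⟨hc, .refl⟩
  | @tail b d _ hs ih =>
    obtain ⟨hb, hr⟩ := ih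
    obtain ⟨hd, hr'⟩ := M.restrict_step P hP ⟨b.1, hb⟩ b.2 hs
    exact ⟨hd, hr.tail hr'⟩

end StkMach

namespace TrMach

open Turing Turing.PartrecToTM2

/-- The statements of the translated machine. -/
abbrev St : Type := TM2.Stmt (fun _ : K' => Γ') Λ' (Option Γ')

def mkey : St → K'
  | .push k _ _ => k
  | .peek k _ _ => k
  | .pop k _ _ => k
  | _ => K'.main

def mnxt : St → Option Γ' → Option Γ' → Option ((St × Option Γ') × List Γ')
  | .push _ f s, v, x => some ((s, v), f v :: x.toList)
  | .peek _ f s, v, x => some ((s, f v x), x.toList)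
  | .pop _ f s, v, x => some ((s, f v x), [])
  | .load f s, v, x => some ((s, f v), x.toList)
  | .branch f s₁ s₂, v, x => some ((cond (f v) s₁ s₂, v), x.toList)
  | .goto l, v, x => some ((tr (l v), v), x.toList)
  | .halt, _, _ => none

/-- The elementary machine. -/
def mach : StkMach (St × Option Γ') K' Γ' where
  key q := mkey q.1
  nxt q x := mnxt q.1 q.2 x
  rej q x := q.1 = .halt ∧ x = some Γ'.cons
  rej_halt := by
    rintro ⟨q, v⟩ x ⟨h, -⟩
    simp only at h
    subst h
    rfl

/-- Translation of configurations. -/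
def rep : TM2.Cfg (fun _ : K' => Γ') Λ' (Option Γ') → (St × Option Γ') × (K' → List Γ')
  | ⟨some l, v, S⟩ => ((tr l, v), S)
  | ⟨none, v, S⟩ => ((.halt, v), S)

theorem toList_head_tail {α : Type} (l : List α) : l.head?.toList ++ l.tail = l := by
  cases l <;> rfl

theorem reach_aux (s : St) (v : Option Γ') (S : K' → List Γ') :
    Relation.ReflTransGen (fun a b => b ∈ mach.step a) ((s, v), S) (rep (TM2.stepAux s v S)) := by
  induction s generalizing v S with
  | push k f s ih =>
    refine Relation.ReflTransGen.head ?_ (ih _ _)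
    simp [StkMach.step, mach, mkey, mnxt, toList_head_tail]
  | peek k f s ih =>
    refine Relation.ReflTransGen.head ?_ (ih _ _)
    simp [StkMach.step, mach, mkey, mnxt, toList_head_tail]
  | pop k f s ih =>
    refine Relation.ReflTransGen.head ?_ (ih _ _)
    simp [StkMach.step, mach, mkey, mnxt]
  | load f s ih =>
    refine Relation.ReflTransGen.head ?_ (ih _ _)
    simp [StkMach.step, mach, mkey, mnxt, toList_head_tail]
  | branch f s₁ s₂ ih₁ ih₂ =>
    cases h : f v with
    | true =>
      simp only [TM2.stepAux, h, cond_true]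
      refine Relation.ReflTransGen.head ?_ (ih₁ _ _)
      simp [StkMach.step, mach, mkey, mnxt, toList_head_tail, h]
    | false =>
      simp only [TM2.stepAux, h, cond_false]
      refine Relation.ReflTransGen.head ?_ (ih₂ _ _)
      simp [StkMach.step, mach, mkey, mnxt, toList_head_tail, h]
  | goto l =>
    refine Relation.ReflTransGen.single ?_
    simp [StkMach.step, mach, mkey, mnxt, toList_head_tail, rep]
  | halt => exact .refl

theorem reach_rep {c c' : TM2.Cfg (fun _ : K' => Γ') Λ' (Option Γ')}
    (h : Relation.ReflTransGen (fun a b => b ∈ TM2.step tr a) c c') :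
    Relation.ReflTransGen (fun a b => b ∈ mach.step a) (rep c) (rep c') := by
  induction h with
  | refl => exact .refl
  | @tail b d _ hs ih =>
    refine ih.trans ?_
    obtain ⟨_ | l, v, S⟩ := b
    · cases hs
    · simp only [TM2.step, Option.mem_def, Option.some.injEq] at hs
      subst hs
      exact reach_aux _ _ _

open Classical in
/-- The reachable states. -/
noncomputable def good (c : ToPartrec.Code) : Finset St :=
  insert .halt ((codeSupp c Cont'.halt).biUnion fun l => TM2.stmts₁ (tr l))

theorem good_sub {c : ToPartrec.Code} {s s' : St} (h : s ∈ good c) (h' : s' ∈ TM2.stmts₁ s) :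
    s' ∈ good c := by
  classical
  simp only [good, Finset.mem_insert, Finset.mem_biUnion] at h ⊢
  rcases h with rfl | ⟨l, hl, h⟩
  · simp [TM2.stmts₁] at h'
    exact Or.inl h'
  · exact Or.inr ⟨l, hl, TM2.stmts₁_trans h h'⟩

theorem good_supp {c : ToPartrec.Code} {s : St} (h : s ∈ good c) :
    TM2.SupportsStmt (codeSupp c Cont'.halt) s := by
  classical
  simp only [good, Finset.mem_insert, Finset.mem_biUnion] at h
  rcases h with rfl | ⟨l, hl, h⟩
  · trivial
  · exact TM2.stmts₁_supportsStmt_mono h ((tr_supports c Cont'.halt).2 l hl)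

theorem good_tr {c : ToPartrec.Code} {l : Λ'} (h : l ∈ codeSupp c Cont'.halt) : tr l ∈ good c := by
  classical
  exact Finset.mem_insert_of_mem (Finset.mem_biUnion.2 ⟨l, h, TM2.stmts₁_self⟩)

theorem good_closed (c : ToPartrec.Code) (q : St × Option Γ') (x : Option Γ')
    (q' : St × Option Γ') (w : List Γ') (hq : q.1 ∈ good c) (h : mach.nxt q x = some (q', w)) :
    q'.1 ∈ good c := by
  classical
  obtain ⟨s, v⟩ := q
  cases s with
  | branch f s₁ s₂ =>
    simp only [mach, mnxt, Option.some.injEq, Prod.mk.injEq] at h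
    obtain ⟨rfl, -⟩ := h
    refine good_sub hq ?_
    cases f v <;> simp [TM2.stmts₁, TM2.stmts₁_self]
  | goto l =>
    simp only [mach, mnxt, Option.some.injEq, Prod.mk.injEq] at h
    obtain ⟨rfl, -⟩ := h
    exact good_tr (good_supp hq v)
  | halt => simp [mach, mnxt] at h
  | _ =>
    simp only [mach, mnxt, Option.some.injEq, Prod.mk.injEq] at h
    obtain ⟨rfl, -⟩ := h
    refine good_sub hq ?_
    simp [TM2.stmts₁, TM2.stmts₁_self]

theorem exists_machine (f : ℕ →. ℕ) (hf : Nat.Partrec f) :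
    ∃ (Q : Type) (_ : Finite Q) (M : StkMach Q K' Γ') (q0 : Q), ∀ n,
      (0 ∈ f n → ∃ c', Relation.ReflTransGen (fun a b => b ∈ M.step a)
        (q0, K'.elim (trList [n]) [] [] []) c' ∧ M.rej c'.1 (c'.2 (M.key c'.1)).head?) ∧
      (1 ∈ f n → ∃ c', Relation.ReflTransGen (fun a b => b ∈ M.step a)
        (q0, K'.elim (trList [n]) [] [] []) c' ∧ M.step c' = none ∧
          ¬ M.rej c'.1 (c'.2 (M.key c'.1)).head?) := by
  obtain ⟨c, hc⟩ := ToPartrec.Code.exists_code (Nat.Partrec'.part_iff₁.2 (Partrec.nat_iff.2 hf))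
  set P : Set (St × Option Γ') := {q | q.1 ∈ good c} with hP
  have hcl : ∀ q x q' w, q ∈ P → mach.nxt q x = some (q', w) → q' ∈ P :=
    fun q x q' w h h' => good_closed c q x q' w h h'
  have hfin : P.Finite := by
    refine (((good c).finite_toSet).prod (Set.finite_univ (α := Option Γ'))).subset ?_
    rintro ⟨s, v⟩ h
    exact ⟨h, trivial⟩
  have h0 : ((tr (trNormal c Cont'.halt), none) : St × Option Γ') ∈ P :=
    good_tr (codeSupp_self c _ (trStmts₁_self _))
  refine ⟨P, hfin.to_subtype, mach.restrict P, ⟨_, h0⟩, ?_⟩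
  have key : ∀ n m, m ∈ f n → ∃ hh : ((.halt, none) : St × Option Γ') ∈ P,
      Relation.ReflTransGen (fun a b => b ∈ (mach.restrict P).step a)
        (⟨_, h0⟩, K'.elim (trList [n]) [] [] []) (⟨_, hh⟩, K'.elim (trList [m]) [] [] []) := by
    intro n m hm
    have h1 : [m] ∈ c.eval [n] := by
      have h2 : c.eval [n] = pure <$> f n := hc (n ::ᵥ List.Vector.nil)
      rw [h2]
      exact Part.mem_map _ hm
    have h2 : halt [m] ∈ StateTransition.eval (TM2.step tr) (init c [n]) := by
      rw [tr_eval]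
      exact Part.mem_map _ h1
    have h3 := reach_rep (StateTransition.mem_eval.1 h2).1
    exact mach.restrict_reach P hcl h3 h0
  intro n
  constructor
  · intro hm
    obtain ⟨hh, hr⟩ := key n 0 hm
    refine ⟨_, hr, ?_⟩
    refine ⟨rfl, ?_⟩
    simp [StkMach.restrict, mach, mkey, trList]
  · intro hm
    obtain ⟨hh, hr⟩ := key n 1 hm
    refine ⟨_, hr, ?_, ?_⟩
    · apply StkMach.restrict_step_none
      simp [StkMach.step, mach, mnxt]
    · rintro ⟨-, h⟩
      simp [StkMach.restrict, mach, mkey, trList, trNat, trNum, trPosNum] at h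

theorem trNat_pow (n : ℕ) : trNat (16 ^ n) = List.replicate (4 * n) Γ'.bit0 ++ [Γ'.bit1] := by
  have h : ∀ m : ℕ, ∃ p : PosNum, ((2 ^ m : ℕ) : Num) = Num.pos p ∧
      trPosNum p = List.replicate m Γ'.bit0 ++ [Γ'.bit1] := by
    intro m
    induction m with
    | zero => exact ⟨1, by simp; rfl, rfl⟩
    | succ m ih =>
      obtain ⟨p, h1, h2⟩ := ih
      refine ⟨p.bit0, ?_, ?_⟩
      · rw [pow_succ, mul_comm, Nat.cast_mul, h1]
        have : ((2 : ℕ) : Num) * Num.pos p = Num.pos p + Num.pos p := by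
          rw [Nat.cast_two, two_mul]
        rw [this]
        have := Num.bit0_of_bit0 (Num.pos p)
        exact this
      · simp [trPosNum, h2, List.replicate_succ]
  obtain ⟨p, h1, h2⟩ := h (4 * n)
  rw [trNat, show 16 ^ n = 2 ^ (4 * n) by rw [pow_mul]; norm_num, h1]
  exact h2

end TrMach

/-! ## Part 6: diagonalization -/

theorem exists_diag : ∃ U : ℕ →. ℕ, Nat.Partrec U ∧ ∀ g : ℕ → Bool, Computable g →
    (∀ n, 0 ∈ U (16 ^ n) → g n = true) → (∀ n, 1 ∈ U (16 ^ n) → g n = false) → False := by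
  have hprim : Primrec₂ fun a b : ℕ => a ^ b := Primrec₂.unpaired'.1 Nat.Primrec.pow
  refine ⟨fun m => (Nat.rfind fun n => Part.some (decide (16 ^ n = m))).bind fun n =>
    Nat.Partrec.Code.eval (Denumerable.ofNat Nat.Partrec.Code n) n, ?_, ?_⟩
  · refine Partrec.nat_iff.1 ?_
    refine Partrec.bind ?_ ?_
    · refine Partrec.rfind ?_
      have h1 : PrimrecPred fun p : ℕ × ℕ => 16 ^ p.2 = p.1 :=
        Primrec.eq.comp (hprim.comp (Primrec.const 16) Primrec.snd) Primrec.fst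
      exact h1.decide.to_comp.partrec
    · exact Nat.Partrec.Code.eval_part.comp
        ((Computable.ofNat Nat.Partrec.Code).comp Computable.snd) Computable.snd
  · intro g hg h0 h1
    have hc : Computable fun n => if g n = true then 1 else 0 := by
      have := Computable.cond hg (Computable.const 1) (Computable.const (α := ℕ) 0)
      refine this.of_eq fun n => ?_
      cases g n <;> rfl
    obtain ⟨e, he⟩ := Nat.Partrec.Code.exists_code.1 (Partrec.nat_iff.1 hc.partrec)
    have key : ∀ v, v = (if g (Encodable.encode e) = true then 1 else 0) →
        v ∈ (Nat.rfind fun n => Part.some (decide (16 ^ n = 16 ^ (Encodable.encode e)))).bind fun n =>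
          Nat.Partrec.Code.eval (Denumerable.ofNat Nat.Partrec.Code n) n := by
      intro v hv
      refine Part.mem_bind_iff.2 ⟨Encodable.encode e, ?_, ?_⟩
      · refine Nat.mem_rfind.2 ⟨?_, ?_⟩
        · simp
        · intro m hm
          have : (16 ^ m : ℕ) ≠ 16 ^ (Encodable.encode e) := fun h =>
            hm.ne (Nat.pow_right_injective (by norm_num) h)
          simp [this]
      · rw [Denumerable.ofNat_encode, he]
        simp [hv]
    cases hgn : g (Encodable.encode e) with
    | true =>
      have := h1 _ (key 1 (by simp [hgn]))
      simp [hgn] at this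
    | false =>
      have := h0 _ (key 0 (by simp [hgn]))
      simp [hgn] at this

/-! ## Part 7: terms, sentences and their codes -/

namespace GrpTm

open FirstOrder FirstOrder.Language

/-- Terms in `k` bound variables. -/
abbrev Tm (k : ℕ) : Type := grpLang.Term (Empty ⊕ Fin k)

/-- Multiplication of terms. -/
def tmul {k : ℕ} (a b : Tm k) : Tm k := Term.func (l := 2) (Unit.unit : grpLang.Functions 2) ![a, b]

/-- Inversion of terms. -/
def tinv {k : ℕ} (a : Tm k) : Tm k := Term.func (l := 1) (Unit.unit : grpLang.Functions 1) ![a]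

/-- The identity. -/
def tone {k : ℕ} : Tm k := Term.func (l := 0) (Unit.unit : grpLang.Functions 0) ![]

/-- The bound variables. -/
def tvar {k : ℕ} (i : Fin k) : Tm k := Term.var (Sum.inr i)

/-- Commutators of terms. -/
def tcmt {k : ℕ} (a b : Tm k) : Tm k := tmul (tmul (tmul (tinv a) (tinv b)) a) b

/-- The action of letters on terms. -/
def tact {k : ℕ} {L : Type} (e : Fin 4 → Fin 4 → L → Tm k) (v : Fin 4 → Tm k) (s : L) : Fin 4 → Tm k :=
  fun j => tcmt (v (j + 1)) (e (j + 1) j s)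

section realize
variable {G : Type} [Group G] {k : ℕ} (xs : Fin k → G)

/-- Evaluation of terms. -/
def ev (t : Tm k) : G := t.realize (Sum.elim (default : Empty → G) xs)

theorem ev_mul (a b : Tm k) : ev xs (tmul a b) = ev xs a * ev xs b := rfl

theorem ev_inv (a : Tm k) : ev xs (tinv a) = (ev xs a)⁻¹ := rfl

theorem ev_one : ev xs (tone : Tm k) = 1 := rfl

theorem ev_var (i : Fin k) : ev xs (tvar i) = xs i := rfl

theorem ev_cmt (a b : Tm k) : ev xs (tcmt a b) = cmt (ev xs a) (ev xs b) := rfl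

theorem ev_act {L : Type} (e : Fin 4 → Fin 4 → L → Tm k) (v : Fin 4 → Tm k) (s : L) :
    (fun j => ev xs (tact e v s j)) = actF (fun i j s => ev xs (e i j s)) (fun j => ev xs (v j)) s :=
  rfl

theorem ev_foldl {L : Type} (e : Fin 4 → Fin 4 → L → Tm k) (v : Fin 4 → Tm k) (w : List L) :
    (fun j => ev xs (w.foldl (tact e) v j)) =
      w.foldl (actF (fun i j s => ev xs (e i j s))) (fun j => ev xs (v j)) := by
  induction w generalizing v with
  | nil => rfl
  | cons s w ih => rw [List.foldl_cons, List.foldl_cons, ih, ev_act]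

end realize

/-- The quantifier-free part. -/
def body {k : ℕ} (rels : List (Tm k × Tm k)) (t : Tm k) : grpLang.BoundedFormula Empty k :=
  rels.foldr (fun p ψ => (BoundedFormula.equal p.1 p.2).imp ψ) (BoundedFormula.equal t tone)

theorem body_qf {k : ℕ} (rels : List (Tm k × Tm k)) (t : Tm k) : (body rels t).IsQF := by
  induction rels with
  | nil => exact .of_isAtomic (.equal _ _)
  | cons p rels ih => exact .imp (.of_isAtomic (.equal _ _)) ih

theorem body_realize {G : Type} [Group G] {k : ℕ} (rels : List (Tm k × Tm k)) (t : Tm k)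
    (xs : Fin k → G) : (body rels t).Realize default xs ↔
      ((∀ p ∈ rels, ev xs p.1 = ev xs p.2) → ev xs t = 1) := by
  induction rels with
  | nil => simp only [List.not_mem_nil, false_imp_iff, implies_true, true_imp_iff]; rfl
  | cons p rels ih =>
    have : (body (p :: rels) t).Realize default xs ↔
      (ev xs p.1 = ev xs p.2 → (body rels t).Realize default xs) := Iff.rfl
    rw [this, ih, List.forall_mem_cons]
    tauto

/-- The sentence. -/
def sent {k : ℕ} (rels : List (Tm k × Tm k)) (t : Tm k) : grpLang.Sentence := (body rels t).alls

theorem sent_univ {k : ℕ} (rels : List (Tm k × Tm k)) (t : Tm k) :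
    IsUniversalSentence (sent rels t) := ⟨k, body rels t, body_qf rels t, rfl⟩

theorem sent_realize {G : Type} [Group G] {k : ℕ} (rels : List (Tm k × Tm k)) (t : Tm k) :
    G ⊨ sent rels t ↔
      ∀ xs : Fin k → G, (∀ p ∈ rels, ev xs p.1 = ev xs p.2) → ev xs t = 1 := by
  have h2 := BoundedFormula.realize_alls (φ := body rels t) (v := (default : Empty → G))
  exact h2.trans (forall_congr' fun xs => body_realize rels t xs)

/-! ### Codes -/

theorem encode_map {α : Type*} [Encodable α] (l : List α) :
    Encodable.encode l = Encodable.encode (l.map Encodable.encode) := by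
  induction l with
  | nil => rfl
  | cons a l ih => rw [List.map_cons, Encodable.encode_list_cons, Encodable.encode_list_cons, ih]; rfl

/-- The code of a term as a list of numbers. -/
def LN {k : ℕ} (t : Tm k) : List ℕ := t.listEncode.map Encodable.encode

/-- Code of multiplication. -/
def cmul (k : ℕ) : ℕ :=
  Encodable.encode (Sum.inr ⟨2, (Unit.unit : grpLang.Functions 2)⟩ :
    (Empty ⊕ Fin k) ⊕ (Σ i, grpLang.Functions i))

/-- Code of inversion. -/
def cinv (k : ℕ) : ℕ :=
  Encodable.encode (Sum.inr ⟨1, (Unit.unit : grpLang.Functions 1)⟩ :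
    (Empty ⊕ Fin k) ⊕ (Σ i, grpLang.Functions i))

theorem LN_mul {k : ℕ} (a b : Tm k) : LN (tmul a b) = cmul k :: (LN a ++ LN b) := by
  simp [LN, tmul, Term.listEncode, List.finRange_succ, cmul]

theorem LN_inv {k : ℕ} (a : Tm k) : LN (tinv a) = cinv k :: LN a := by
  simp [LN, tinv, Term.listEncode, List.finRange_succ, cinv]

/-- Commutators on the level of codes. -/
def CN (k : ℕ) (a b : List ℕ) : List ℕ :=
  [cmul k, cmul k, cmul k, cinv k] ++ (a ++ (cinv k :: (b ++ (a ++ b))))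

theorem LN_cmt {k : ℕ} (a b : Tm k) : LN (tcmt a b) = CN k (LN a) (LN b) := by
  simp [tcmt, LN_mul, LN_inv, CN]

theorem CN_primrec (k : ℕ) {f : ℕ → List ℕ} (hf : Primrec f) (b : List ℕ) :
    Primrec fun n => CN k (f n) b :=
  Primrec.list_append.comp (Primrec.const _) (Primrec.list_append.comp hf
    (Primrec.list_cons.comp (Primrec.const _) (Primrec.list_append.comp (Primrec.const _)
      (Primrec.list_append.comp hf (Primrec.const _)))))

theorem CN_primrec' (k : ℕ) {f : List ℕ → List ℕ} (hf : Primrec f) (b : List ℕ) :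
    Primrec fun n => CN k (f n) b :=
  Primrec.list_append.comp (Primrec.const _) (Primrec.list_append.comp hf
    (Primrec.list_cons.comp (Primrec.const _) (Primrec.list_append.comp (Primrec.const _)
      (Primrec.list_append.comp hf (Primrec.const _)))))

theorem foldl_primrec {k : ℕ} {L : Type} (e : Fin 4 → Fin 4 → L → Tm k) (w : List L)
    (V : ℕ → Fin 4 → Tm k) (hV : ∀ j, Primrec fun n => LN (V n j)) (j : Fin 4) :
    Primrec fun n => LN (w.foldl (tact e) (V n) j) := by
  induction w generalizing V with
  | nil => exact hV j
  | cons s w ih =>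
    simp only [List.foldl_cons]
    refine ih (fun n => tact e (V n) s) fun j => ?_
    simp only [tact, LN_cmt]
    exact CN_primrec k (hV _) _

theorem pow_primrec {k : ℕ} {L : Type} (e : Fin 4 → Fin 4 → L → Tm k) (s : L)
    (v : Fin 4 → Tm k) (j : Fin 4) :
    Primrec fun n => LN ((List.replicate (4 * n) s).foldl (tact e) v j) := by
  have hj : j + 1 + 1 + 1 + 1 = j := by revert j; decide
  have key : ∀ n, LN ((List.replicate (4 * n) s).foldl (tact e) v j) =
      (fun x => CN k (CN k (CN k (CN k x (LN (e (j + 1 + 1 + 1 + 1) (j + 1 + 1 + 1) s)))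
        (LN (e (j + 1 + 1 + 1) (j + 1 + 1) s))) (LN (e (j + 1 + 1) (j + 1) s)))
        (LN (e (j + 1) j s)))^[n] (LN (v j)) := by
    intro n
    induction n with
    | zero => rfl
    | succ n ih =>
      rw [Function.iterate_succ_apply', ← ih]
      rw [show 4 * (n + 1) = 4 * n + 4 by ring, List.replicate_add, List.foldl_append]
      simp only [List.replicate, List.foldl_cons, List.foldl_nil]
      rw [tact, LN_cmt, tact, LN_cmt, tact, LN_cmt, tact, LN_cmt]
      rw [show (List.foldl (tact e) v (List.replicate (4 * n) s)) (j + 1 + 1 + 1 + 1) =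
        (List.foldl (tact e) v (List.replicate (4 * n) s)) j by rw [hj] ]
  refine Primrec.of_eq ?_ fun n => (key n).symm
  refine Primrec.nat_iterate Primrec.id (Primrec.const _) ?_
  exact (CN_primrec' k (CN_primrec' k (CN_primrec' k (CN_primrec' k Primrec.id _) _) _) _).comp
    Primrec.snd

theorem sent_code {k : ℕ} (rels : List (Tm k × Tm k)) :
    ∃ (P : List ℕ) (z : ℕ), ∀ t : Tm k, Encodable.encode (sent rels t) =
      Encodable.encode (P ++ [2 * Nat.pair k (Encodable.encode (LN t)), z]) := by
  have h1 : ∃ (P : List ((Σ k, Tm k) ⊕ ((Σ n, grpLang.Relations n) ⊕ ℕ))), ∀ t : Tm k,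
      (body rels t).listEncode = P ++ [Sum.inl ⟨k, t⟩, Sum.inl ⟨k, tone⟩] := by
    induction rels with
    | nil => exact ⟨[], fun t => rfl⟩
    | cons p rels ih =>
      obtain ⟨P, hP⟩ := ih
      refine ⟨Sum.inr (Sum.inr 0) :: Sum.inl ⟨k, p.1⟩ :: Sum.inl ⟨k, p.2⟩ :: P, fun t => ?_⟩
      have : (body (p :: rels) t).listEncode = Sum.inr (Sum.inr 0) :: Sum.inl ⟨k, p.1⟩ ::
        Sum.inl ⟨k, p.2⟩ :: (body rels t).listEncode := rfl
      rw [this, hP]; rfl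
  have h2 : ∀ (m : ℕ), ∃ (P : List ((Σ k, Tm k) ⊕ ((Σ n, grpLang.Relations n) ⊕ ℕ))),
      ∀ φ : grpLang.BoundedFormula Empty m,
        BoundedFormula.listEncode (φ.alls : grpLang.BoundedFormula Empty 0) = P ++ φ.listEncode := by
    intro m
    induction m with
    | zero => exact ⟨[], fun φ => rfl⟩
    | succ m ih =>
      obtain ⟨P, hP⟩ := ih
      refine ⟨P ++ [Sum.inr (Sum.inr 1)], fun φ => ?_⟩
      have : (φ.alls : grpLang.BoundedFormula Empty 0) = φ.all.alls := rfl
      rw [this, hP, List.append_assoc]; rfl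
  obtain ⟨P1, hP1⟩ := h1
  obtain ⟨P2, hP2⟩ := h2 k
  refine ⟨(P2 ++ P1).map Encodable.encode, Encodable.encode (Sum.inl ⟨k, tone⟩ :
    (Σ k, Tm k) ⊕ ((Σ n, grpLang.Relations n) ⊕ ℕ)), fun t => ?_⟩
  have h3 : Encodable.encode (sent rels t) =
    Encodable.encode (BoundedFormula.listEncode (sent rels t : grpLang.BoundedFormula Empty 0)) := rfl
  have h4 : BoundedFormula.listEncode (sent rels t : grpLang.BoundedFormula Empty 0) =
    (P2 ++ P1) ++ [Sum.inl ⟨k, t⟩, Sum.inl ⟨k, tone⟩] := by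
    rw [sent, hP2, hP1, List.append_assoc]
  have h5 : Encodable.encode (Sum.inl ⟨k, t⟩ : (Σ k, Tm k) ⊕ ((Σ n, grpLang.Relations n) ⊕ ℕ)) =
      2 * Nat.pair k (Encodable.encode (LN t)) := by
    rw [Encodable.encode_inl, Encodable.encode_sigma_val]
    have : Encodable.encode t = Encodable.encode (LN t) := encode_map t.listEncode
    rw [this]; rfl
  rw [h3, h4, encode_map, List.map_append, List.map_cons, List.map_cons, List.map_nil, h5]

theorem sent_computable {k : ℕ} (rels : List (Tm k × Tm k)) (t : ℕ → Tm k)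
    (ht : Primrec fun n => LN (t n)) : Computable fun n => Encodable.encode (sent rels (t n)) := by
  obtain ⟨P, z, h⟩ := sent_code rels
  refine Computable.of_eq (Primrec.to_comp ?_) fun n => (h (t n)).symm
  refine Primrec.encode.comp (Primrec.list_append.comp (Primrec.const _)
    (Primrec.list_cons.comp ?_ (Primrec.const _)))
  exact Primrec.nat_mul.comp (Primrec.const _) (Primrec₂.natPair.comp (Primrec.const _)
    (Primrec.encode.comp ht))

end GrpTm

/-! ## Part 8: the relations -/

namespace GrpTm

open StkMach

section rels
variable {Q K A : Type} [DecidableEq K] (M : StkMach Q K A) {k : ℕ}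
  (e : Fin 4 → Fin 4 → Ltr K A → Tm k) (qv : Q → Fin 4 → Tm k)

/-- The relation given by a transition. -/
noncomputable def ruleRel (i : Q × Option A × Fin 4) : Tm k × Tm k :=
  open Classical in
  match M.nxt i.1 i.2.1 with
  | some p => (tact e (qv i.1) (some (M.key i.1, i.2.1)) i.2.2,
      (repl (M.key i.1) i.2.1 p.2).foldl (tact e) (qv p.1) i.2.2)
  | none => if M.rej i.1 i.2.1 then (tact e (qv i.1) (some (M.key i.1, i.2.1)) i.2.2, tone)
      else (tone, tone)

/-- All the relations. -/
noncomputable def relSet : Set (Tm k × Tm k) :=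
  ((fun i : Fin 4 × Fin 4 × Fin 4 × Fin 4 × Ltr K A × Ltr K A =>
    ((tcmt (e i.1 i.2.1 i.2.2.2.2.1) (e i.2.2.1 i.2.2.2.1 i.2.2.2.2.2), tone) : Tm k × Tm k)) ''
      {i | i.1 ≠ i.2.1 ∧ i.2.2.1 ≠ i.2.2.2.1 ∧ i.2.1 ≠ i.2.2.1 ∧ i.1 ≠ i.2.2.2.1}) ∪
  ((fun i : Fin 4 × Fin 4 × Fin 4 × Fin 4 × Ltr K A × Ltr K A =>
    ((tcmt (e i.1 i.2.1 i.2.2.2.2.1) (e i.2.1 i.2.2.2.1 i.2.2.2.2.2),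
      tcmt (e i.1 i.2.2.1 i.2.2.2.2.1) (e i.2.2.1 i.2.2.2.1 i.2.2.2.2.2)) : Tm k × Tm k)) ''
      {i | i.1 ≠ i.2.1 ∧ i.2.1 ≠ i.2.2.2.1 ∧ i.1 ≠ i.2.2.2.1 ∧ i.1 ≠ i.2.2.1 ∧
        i.2.2.1 ≠ i.2.2.2.1}) ∪
  ((fun i : Fin 4 × Fin 4 × Fin 4 × Ltr K A × Ltr K A =>
    ((tcmt (e i.1 i.2.1 i.2.2.2.1) (e i.2.1 i.2.2.1 i.2.2.2.2),
      tcmt (e i.1 i.2.1 i.2.2.2.2) (e i.2.1 i.2.2.1 i.2.2.2.1)) : Tm k × Tm k)) ''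
      {i | Lcomm i.2.2.2.1 i.2.2.2.2 ∧ i.1 ≠ i.2.1 ∧ i.2.1 ≠ i.2.2.1 ∧ i.1 ≠ i.2.2.1}) ∪
  ((fun i : Q × Fin 4 × Fin 4 × Fin 4 × Ltr K A =>
    ((tcmt (qv i.1 i.2.1) (e i.2.2.1 i.2.2.2.1 i.2.2.2.2), tone) : Tm k × Tm k)) ''
      {i | i.2.2.1 ≠ i.2.1 ∧ i.2.2.1 ≠ i.2.2.2.1}) ∪
  ((fun i : Q × Fin 4 × Fin 4 × Fin 4 × Ltr K A =>
    ((tcmt (qv i.1 i.2.1) (e i.2.1 i.2.2.2.1 i.2.2.2.2),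
      tcmt (qv i.1 i.2.2.1) (e i.2.2.1 i.2.2.2.1 i.2.2.2.2)) : Tm k × Tm k)) ''
      {i | i.2.1 ≠ i.2.2.2.1 ∧ i.2.2.1 ≠ i.2.2.2.1}) ∪
  Set.range (ruleRel M e qv)

theorem relSet_finite [Finite Q] [Finite K] [Finite A] : (relSet M e qv).Finite := by
  unfold relSet
  exact (((((Set.toFinite _).union (Set.toFinite _)).union (Set.toFinite _)).union
    (Set.toFinite _)).union (Set.toFinite _)).union (Set.finite_range _)

/-- The semantic counterpart of the relations. -/
structure RelHold {G : Type} [Group G] (e : Fin 4 → Fin 4 → Ltr K A → G) (qv : Q → Fin 4 → G) :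
    Prop where
  er : ERel e Lcomm
  gf : ∀ q, GoodFam e (qv q)
  rule : ∀ q x q' w, M.nxt q x = some (q', w) →
    actF e (qv q) (some (M.key q, x)) = (repl (M.key q) x w).foldl (actF e) (qv q')
  rej : ∀ q x, M.rej q x → actF e (qv q) (some (M.key q, x)) = fun _ => 1

theorem relSet_iff {G : Type} [Group G] (xs : Fin k → G) :
    (∀ p ∈ relSet M e qv, ev xs p.1 = ev xs p.2) ↔
      RelHold M (fun i j s => ev xs (e i j s)) (fun q j => ev xs (qv q j)) := by
  have hact := fun v s j => congrFun (ev_act xs e v s) j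
  have hfold := fun v w j => congrFun (ev_foldl xs e v w) j
  have hrule : (∀ p ∈ Set.range (ruleRel M e qv), ev xs p.1 = ev xs p.2) ↔
      (∀ q x q' w, M.nxt q x = some (q', w) →
        actF (fun i j s => ev xs (e i j s)) (fun j => ev xs (qv q j)) (some (M.key q, x)) =
          (repl (M.key q) x w).foldl (actF (fun i j s => ev xs (e i j s)))
            (fun j => ev xs (qv q' j))) ∧
      (∀ q x, M.rej q x → actF (fun i j s => ev xs (e i j s)) (fun j => ev xs (qv q j))
        (some (M.key q, x)) = fun _ => 1) := by
    rw [Set.forall_mem_range]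
    constructor
    · intro h
      constructor
      · intro q x q' w hn
        funext j
        have := h (q, x, j)
        simp only [ruleRel, hn] at this
        rw [hact, hfold] at this
        exact this
      · intro q x hr
        funext j
        have := h (q, x, j)
        simp only [ruleRel, M.rej_halt q x hr, hr, if_true] at this
        rw [hact] at this
        exact this
    · rintro ⟨h1, h2⟩ ⟨q, x, j⟩
      simp only [ruleRel]
      cases hn : M.nxt q x with
      | some p =>
        simp only
        rw [hact, hfold]
        exact congrFun (h1 q x p.1 p.2 hn) j
      | none =>
        simp only
        split_ifs with hr
        · simp only
          rw [hact]
          exact congrFun (h2 q x hr) j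
        · rfl
  unfold relSet
  simp only [Set.mem_union, or_imp, forall_and]
  rw [hrule]
  simp only [Set.forall_mem_image, Set.mem_setOf_eq, Prod.forall, ev_cmt, ev_one, cmt_eq_one]
  constructor
  · rintro ⟨⟨⟨⟨⟨h1, h2⟩, h3⟩, h4⟩, h5⟩, h6, h7⟩
    refine ⟨⟨?_, ?_, ?_⟩, fun q => ⟨?_, ?_⟩, h6, h7⟩
    · intro i j k l s s' a b c d; exact h1 i j k l s s' ⟨a, b, c, d⟩
    · intro i j j' l s s' a b c d f; exact h2 i j j' l s s' ⟨a, b, c, d, f⟩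
    · intro i j l s s' a b c d; exact h3 i j l s s' ⟨a, b, c, d⟩
    · intro j k l s a b; exact h4 q j k l s ⟨a, b⟩
    · intro j j' k s a b; exact h5 q j j' k s ⟨a, b⟩
  · rintro ⟨⟨h1, h2, h3⟩, h4, h6, h7⟩
    refine ⟨⟨⟨⟨⟨?_, ?_⟩, ?_⟩, ?_⟩, ?_⟩, h6, h7⟩
    · rintro i j k l s s' ⟨a, b, c, d⟩; exact h1 i j k l s s' a b c d
    · rintro i j j' l s s' ⟨a, b, c, d, f⟩; exact h2 i j j' l s s' a b c d f
    · rintro i j l s s' ⟨a, b, c, d⟩; exact h3 i j l s s' a b c d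
    · rintro q j k l s ⟨a, b⟩; exact (h4 q).g1 j k l s a b
    · rintro q j j' k s ⟨a, b⟩; exact (h4 q).g2 j j' k s a b

end rels

theorem one_good {G L : Type} [Group G] (e : Fin 4 → Fin 4 → L → G) : GoodFam e (fun _ => 1) where
  g1 _ _ _ _ _ _ := Commute.one_left _
  g2 _ _ _ _ _ _ := by simp [cmt]

theorem rej_one {Q K A : Type} [DecidableEq K] (M : StkMach Q K A) {G : Type} [Group G]
    {e : Fin 4 → Fin 4 → Ltr K A → G} {qv : Q → Fin 4 → G} (h : RelHold M e qv)
    {ks : List K} (hnd : ks.Nodup) (hks : ∀ k, k ∈ ks) {c c' : Q × (K → List A)}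
    (hr : Relation.ReflTransGen (fun a b => b ∈ M.step a) c c')
    (hfin : M.rej c'.1 (c'.2 (M.key c'.1)).head?) :
    (full ks c.2).foldl (actF e) (qv c.1) = fun _ => 1 := by
  let act : {v // GoodFam e v} → Ltr K A → {v // GoodFam e v} :=
    fun v s => ⟨actF e v.1 s, actF_good h.er v.2 s⟩
  have hval : ∀ (w : List (Ltr K A)) (v : {v // GoodFam e v}),
      (w.foldl act v).1 = w.foldl (actF e) v.1 := by
    intro w
    induction w with
    | nil => intro v; rfl
    | cons s w ih => intro v; rw [List.foldl_cons, List.foldl_cons, ih]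
  have key := sim act M (fun v s s' hs => Subtype.ext (actF_comm h.er v.2 hs))
    (fun q => ⟨qv q, h.gf q⟩)
    (fun q x q' w hn => Subtype.ext (by rw [hval]; exact h.rule q x q' w hn))
    ⟨fun _ => 1, one_good e⟩
    (fun s => Subtype.ext (by funext j; simp [act, actF, cmt]))
    (fun q x hq => Subtype.ext (h.rej q x hq)) hnd hks hr hfin
  have := congrArg Subtype.val key
  rw [hval] at this
  exact this

theorem acc_ne_one {Q K A : Type} [DecidableEq K] [DecidableEq A] [Finite K] [Finite A]
    (M : StkMach Q K A)
    {ks : List K} (hnd : ks.Nodup) (hks : ∀ k, k ∈ ks) {c c' : Q × (K → List A)}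
    (hr : Relation.ReflTransGen (fun a b => b ∈ M.step a) c c') (hst : M.step c' = none)
    (hfin : ¬ M.rej c'.1 (c'.2 (M.key c'.1)).head?) :
    ∃ (G : Type) (_ : Group G) (_ : Finite G) (e : Fin 4 → Fin 4 → Ltr K A → G)
      (qv : Q → Fin 4 → G), RelHold M e qv ∧ (full ks c.2).foldl (actF e) (qv c.1) 0 ≠ 1 := by
  obtain ⟨R, _, _, m, mq, h1, h2, h3, h4⟩ := M.exists_ring hnd hks hr hst hfin
  refine ⟨(Matrix (Option (Fin 4)) (Option (Fin 4)) R)ˣ, inferInstance, inferInstance, modE m,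
    fun q => modV (mq q), ⟨modE_rel m _ h1, fun q => modV_good m _, ?_, ?_⟩, ?_⟩
  · intro q x q' w hn
    rw [modV_act, modV_foldl, h2 q x q' w hn]
  · intro q x hq
    rw [modV_act, h3 q x hq]
    funext j
    exact tvec_zero _ _
  · rw [modV_foldl]
    exact tvec_ne_one (by simp) h4

open Turing.PartrecToTM2 in
/-- The separating sentences. -/
theorem exists_sentences (U : ℕ →. ℕ) (hU : Nat.Partrec U) :
    ∃ φ : ℕ → grpLang.Sentence, (∀ n, IsUniversalSentence (φ n)) ∧
      Computable (fun n => Encodable.encode (φ n)) ∧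
      (∀ n, 0 ∈ U (16 ^ n) → ∀ (G : Type) [Group G], G ⊨ φ n) ∧
      (∀ n, 1 ∈ U (16 ^ n) → ∃ (G : Type) (_ : Group G), Finite G ∧ ¬ G ⊨ φ n) := by
  obtain ⟨Q, hQ, M, q0, hM⟩ := TrMach.exists_machine U hU
  have hKf : Finite K' := by
    refine Set.finite_univ_iff.1 (Set.Finite.subset (Set.toFinite {K'.main, K'.rev, K'.aux, K'.stack}) ?_)
    intro x _
    cases x <;> simp
  obtain ⟨k, ⟨ν⟩⟩ := Finite.exists_equiv_fin
    ((Fin 4 × Fin 4 × Ltr K' Γ') ⊕ (Q × Fin 4))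
  let e : Fin 4 → Fin 4 → Ltr K' Γ' → Tm k := fun i j s => tvar (ν (Sum.inl (i, j, s)))
  let qv : Q → Fin 4 → Tm k := fun q j => tvar (ν (Sum.inr (q, j)))
  let ks : List K' := [K'.main, K'.rev, K'.aux, K'.stack]
  have hnd : ks.Nodup := by decide
  have hks : ∀ x, x ∈ ks := by intro x; cases x <;> decide
  let rels : List (Tm k × Tm k) := (relSet_finite M e qv).toFinset.toList
  have hrels : ∀ p, p ∈ rels ↔ p ∈ relSet M e qv := by intro p; simp [rels]
  let S : ℕ → K' → List Γ' := fun n => K'.elim (trList [16 ^ n]) [] [] []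
  let t : ℕ → Tm k := fun n => (full ks (S n)).foldl (tact e) (qv q0) 0
  have hfull : ∀ n, full ks (S n) = List.replicate (4 * n) (some (K'.main, some Γ'.bit0)) ++
      [some (K'.main, some Γ'.bit1), some (K'.main, some Γ'.cons), some (K'.main, none),
        some (K'.rev, none), some (K'.aux, none), some (K'.stack, none)] := by
    intro n
    simp [full, ks, S, trList, TrMach.trNat_pow, wlet, emark]
  have ht : Primrec fun n => LN (t n) := by
    have : ∀ n, t n = ([some (K'.main, some Γ'.bit1), some (K'.main, some Γ'.cons),
        some (K'.main, none), some (K'.rev, none), some (K'.aux, none),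
        some (K'.stack, none)] : List (Ltr K' Γ')).foldl (tact e)
          ((List.replicate (4 * n) (some (K'.main, some Γ'.bit0))).foldl (tact e) (qv q0)) 0 := by
      intro n
      simp only [t]
      rw [hfull, List.foldl_append]
    simp only [this]
    exact foldl_primrec e _ _ (fun j => pow_primrec e _ _ j) 0
  have hev : ∀ {G : Type} [Group G] (xs : Fin k → G) n, ev xs (t n) =
      (full ks (S n)).foldl (actF (fun i j s => ev xs (e i j s))) (fun j => ev xs (qv q0 j)) 0 :=
    fun xs n => congrFun (ev_foldl xs e (qv q0) (full ks (S n))) 0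
  refine ⟨fun n => sent rels (t n), fun n => sent_univ _ _, sent_computable rels t ht, ?_, ?_⟩
  · intro n hn G _
    rw [sent_realize]
    intro xs hxs
    obtain ⟨c', hr, hrej⟩ := (hM (16 ^ n)).1 hn
    have hR := (relSet_iff M e qv xs).1 fun p hp => hxs p ((hrels p).2 hp)
    have := rej_one M hR hnd hks hr hrej
    rw [hev]
    exact congrFun this 0
  · intro n hn
    obtain ⟨c', hr, hst, hrej⟩ := (hM (16 ^ n)).2 hn
    obtain ⟨G, hG, hGf, e', qv', hR, hne⟩ := acc_ne_one M hnd hks hr hst hrej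
    refine ⟨G, hG, hGf, ?_⟩
    rw [sent_realize]
    intro hall
    let xs : Fin k → G := fun i => Sum.elim (fun p => e' p.1 p.2.1 p.2.2) (fun p => qv' p.1 p.2) (ν.symm i)
    have he : (fun i j s => ev xs (e i j s)) = e' := by
      funext i j s; simp [e, ev_var, xs]
    have hq : (fun q j => ev xs (qv q j)) = qv' := by
      funext q j; simp [qv, ev_var, xs]
    have hq0 : (fun j => ev xs (qv q0 j)) = qv' q0 := congrFun hq q0
    have := hall xs fun p hp => (relSet_iff M e qv xs).2 (by rw [he, hq]; exact hR) p ((hrels p).1 hp)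
    rw [hev, he, hq0] at this
    exact hne this

end GrpTm

/-- Any set of sentences squeezed between the universal theory of torsion groups and the
universal theory of finite groups is undecidable. -/
theorem undecidable_of_between_torsion_and_finite (T : Set grpLang.Sentence)
    (h1 : UnivTheoryOf (fun G inst => letI := inst; Monoid.IsTorsion G) ⊆ T)
    (h2 : T ⊆ UnivTheoryOf (fun G _ => Finite G)) :
    ¬ ∃ f : ℕ → Bool, Computable f ∧
      ∀ φ : grpLang.Sentence, (f (Encodable.encode φ) = true ↔ φ ∈ T) := by
  rintro ⟨f, hf, hfT⟩
  obtain ⟨U, hU, hdiag⟩ := exists_diag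
  obtain ⟨φ, huniv, hcomp, h0, hone⟩ := GrpTm.exists_sentences U hU
  refine hdiag (fun n => f (Encodable.encode (φ n))) (hf.comp hcomp) ?_ ?_
  · intro n hn
    refine (hfT _).2 (h1 ⟨huniv n, ?_⟩)
    intro G inst _
    exact h0 n hn G
  · intro n hn
    rw [← Bool.not_eq_true]
    intro ht
    obtain ⟨G, hG, hGf, hne⟩ := hone n hn
    exact hne ((h2 ((hfT _).1 ht)).2 G hGf)
end
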